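/- arXiv:2306.04113 — 4 statements merged into one kernel-verified Lean document; each statement's English description precedes it below -/
import Mathlib

section
/- Let L be a finite semidistributive lattice with more than two elements having an isolated interval [a, b], let L^{a,b} = L ∖ {a, b}, let F be an FN lattice, and let K = L^{a,b} ⊔ F be ordered by: on L^{a,b}, the order of L; on F, the order of F; for x ∈ L^{a,b} and y ∈ F, x < y iff x ≤ a in L, and y < x iff b ≤ x in L. Then the lattice K is semidistributive. -/
/-! ### Basic definitions: semidistributivity, lattice congruences -/

/-- Join-semidistributivity: `u = x ⊔ y = x ⊔ z` implies `u = x ⊔ (y ⊓ z)`. -/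
def JoinSD (L : Type*) [Lattice L] : Prop :=
  ∀ u x y z : L, u = x ⊔ y → u = x ⊔ z → u = x ⊔ (y ⊓ z)

/-- Meet-semidistributivity: `w = x ⊓ y = x ⊓ z` implies `w = x ⊓ (y ⊔ z)`. -/
def MeetSD (L : Type*) [Lattice L] : Prop :=
  ∀ w x y z : L, w = x ⊓ y → w = x ⊓ z → w = x ⊓ (y ⊔ z)

/-- Semidistributivity. -/
def SD (L : Type*) [Lattice L] : Prop := JoinSD L ∧ MeetSD L

/-- A congruence of a lattice: an equivalence relation compatible with `⊔` and `⊓`. -/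
@[ext]
structure LatCon (L : Type*) [Lattice L] where
  r : L → L → Prop
  refl' : ∀ x, r x x
  symm' : ∀ {x y}, r x y → r y x
  trans' : ∀ {x y z}, r x y → r y z → r x z
  sup' : ∀ {x y x' y'}, r x y → r x' y' → r (x ⊔ x') (y ⊔ y')
  inf' : ∀ {x y x' y'}, r x y → r x' y' → r (x ⊓ x') (y ⊓ y')

namespace LatCon

variable {L : Type*} [Lattice L]

/-- Congruences are ordered by inclusion; this is the order of the congruence
lattice `Con L`. -/
instance instPO : PartialOrder (LatCon L) where
  le c d := ∀ x y, c.r x y → d.r x y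
  le_refl _ _ _ h := h
  le_trans _ _ _ h1 h2 x y h := h2 x y (h1 x y h)
  le_antisymm c d h1 h2 := by
    ext x y
    exact ⟨h1 x y, h2 x y⟩

/-- The congruence lattice `Con L`. -/
instance instLattice : Lattice (LatCon L) where
  sup c d :=
    { r := fun x y => ∀ e : LatCon L, c ≤ e → d ≤ e → e.r x y
      refl' := fun x e _ _ => e.refl' x
      symm' := fun h e hc hd => e.symm' (h e hc hd)
      trans' := fun h1 h2 e hc hd => e.trans' (h1 e hc hd) (h2 e hc hd)
      sup' := fun h1 h2 e hc hd => e.sup' (h1 e hc hd) (h2 e hc hd)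
      inf' := fun h1 h2 e hc hd => e.inf' (h1 e hc hd) (h2 e hc hd) }
  le_sup_left c d := fun x y h e hc _ => hc x y h
  le_sup_right c d := fun x y h e _ hd => hd x y h
  sup_le c d e hc hd := fun x y h => h e hc hd
  inf c d :=
    { r := fun x y => c.r x y ∧ d.r x y
      refl' := fun x => ⟨c.refl' x, d.refl' x⟩
      symm' := fun h => ⟨c.symm' h.1, d.symm' h.2⟩
      trans' := fun h1 h2 => ⟨c.trans' h1.1 h2.1, d.trans' h1.2 h2.2⟩
      sup' := fun h1 h2 => ⟨c.sup' h1.1 h2.1, d.sup' h1.2 h2.2⟩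
      inf' := fun h1 h2 => ⟨c.inf' h1.1 h2.1, d.inf' h1.2 h2.2⟩ }
  inf_le_left c d := fun x y h => h.1
  inf_le_right c d := fun x y h => h.2
  le_inf c d e hc hd := fun x y h => ⟨hc x y h, hd x y h⟩

/-- The equality congruence is the least congruence. -/
instance instOrderBot : OrderBot (LatCon L) where
  bot :=
    { r := Eq
      refl' := fun _ => rfl
      symm' := Eq.symm
      trans' := Eq.trans
      sup' := by rintro x y x' y' rfl rfl; rfl
      inf' := by rintro x y x' y' rfl rfl; rfl }
  bot_le c := by rintro x y rfl; exact c.refl' x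

/-- The all congruence is the greatest congruence. -/
instance instOrderTop : OrderTop (LatCon L) where
  top :=
    { r := fun _ _ => True
      refl' := fun _ => trivial
      symm' := fun _ => trivial
      trans' := fun _ _ => trivial
      sup' := fun _ _ => trivial
      inf' := fun _ _ => trivial }
  le_top _ _ _ _ := trivial

/-- The congruence generated by a pair `(a, b)`. -/
def gen (a b : L) : LatCon L where
  r x y := ∀ c : LatCon L, c.r a b → c.r x y
  refl' x := fun c _ => c.refl' x
  symm' h := fun c hc => c.symm' (h c hc)
  trans' h1 h2 := fun c hc => c.trans' (h1 c hc) (h2 c hc)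
  sup' h1 h2 := fun c hc => c.sup' (h1 c hc) (h2 c hc)
  inf' h1 h2 := fun c hc => c.inf' (h1 c hc) (h2 c hc)

/-- The congruence generated by a set of pairs. -/
def genSet (P : Set (L × L)) : LatCon L where
  r x y := ∀ c : LatCon L, (∀ p ∈ P, c.r p.1 p.2) → c.r x y
  refl' x := fun c _ => c.refl' x
  symm' h := fun c hc => c.symm' (h c hc)
  trans' h1 h2 := fun c hc => c.trans' (h1 c hc) (h2 c hc)
  sup' h1 h2 := fun c hc => c.sup' (h1 c hc) (h2 c hc)
  inf' h1 h2 := fun c hc => c.inf' (h1 c hc) (h2 c hc)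

end LatCon

/-- A lattice is simple if its congruence lattice has exactly two elements, namely
the equality relation (`⊥`) and the all relation (`⊤`). -/
def IsSimpleLat (L : Type*) [Lattice L] : Prop :=
  (∃ x y : L, x ≠ y) ∧ ∀ c : LatCon L, c = (⊥ : LatCon L) ∨ c = (⊤ : LatCon L)

/-- An FN lattice: a simple, infinite, semidistributive lattice. -/
def IsFN (F : Type*) [Lattice F] : Prop := Infinite F ∧ IsSimpleLat F ∧ SD F

/-! ### Helpers for quantifying over lattice structures -/

/-- `SD` for an explicitly given lattice structure. -/
def SDP (K : Type*) (instK : Lattice K) : Prop := by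
  letI := instK; exact SD K

/-- `IsFN` for an explicitly given lattice structure. -/
def IsFNP (F : Type*) (instF : Lattice F) : Prop := by
  letI := instF; exact IsFN F

/-- The congruence lattice of `K` (with explicitly given lattice structure) is
order-isomorphic to `D`. -/
def ConIso (K : Type*) (instK : Lattice K) (D : Type*) [LE D] : Prop := by
  letI := instK; exact Nonempty (LatCon K ≃o D)

/-- `K` (with explicitly given lattice structure) has no greatest and no least element. -/
def UnboundedP (K : Type*) (instK : Lattice K) : Prop := by
  letI := instK; exact (∀ x : K, ¬ IsTop x) ∧ (∀ x : K, ¬ IsBot x)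

/-- The order `≤` of an explicitly given lattice structure. -/
def lleOf {α : Type*} (inst : Lattice α) (x y : α) : Prop := by
  letI := inst; exact x ≤ y

/-- The join of an explicitly given lattice structure. -/
def lsupOf {α : Type*} (inst : Lattice α) (x y : α) : α := by
  letI := inst; exact x ⊔ y

/-- The meet of an explicitly given lattice structure. -/
def linfOf {α : Type*} (inst : Lattice α) (x y : α) : α := by
  letI := inst; exact x ⊓ y

/-! ### The doubling construction -/

/-- The underlying set of the doubling `L[u]`: `(L ∖ {u}) ∪ {u₀, u₁}`, where
`u₀ = Sum.inr false` and `u₁ = Sum.inr true`. -/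
def Doubled (L : Type*) (u : L) : Type _ := {x : L // x ≠ u} ⊕ Bool

/-- The element `u₀` of `L[u]`. -/
def dbl0 {L : Type*} (u : L) : Doubled L u := Sum.inr false

/-- The element `u₁` of `L[u]`. -/
def dbl1 {L : Type*} (u : L) : Doubled L u := Sum.inr true

/-- The order `≤ᵤ` of the doubling `L[u]`. -/
def dle {L : Type*} [Lattice L] (u : L) : Doubled L u → Doubled L u → Prop
  | Sum.inl x, Sum.inl y => (x : L) ≤ y
  | Sum.inl x, Sum.inr _ => (x : L) ≤ u
  | Sum.inr _, Sum.inl y => u ≤ (y : L)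
  | Sum.inr i, Sum.inr j => i ≤ j

section
open Classical

/-- The map `L → L[u]` sending `u` to `u₀` and fixing everything else. -/
noncomputable def iota0 {L : Type*} (u : L) : L → Doubled L u := fun x =>
  if h : x = u then Sum.inr false else Sum.inl ⟨x, h⟩

/-- The map `L → L[u]` sending `u` to `u₁` and fixing everything else. -/
noncomputable def iota1 {L : Type*} (u : L) : L → Doubled L u := fun x =>
  if h : x = u then Sum.inr true else Sum.inl ⟨x, h⟩

end

/-- The projection `L[u] → L` collapsing `u₀` and `u₁` to `u`. -/
def dproj {L : Type*} (u : L) : Doubled L u → L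
  | Sum.inl x => (x : L)
  | Sum.inr _ => u

/-! ### Doubling a finite antichain -/

/-- The underlying set of `L[U]`: `(L ∖ U) ∪ ⋃_{u ∈ U} {u₀, u₁}`, where
`u₀ = Sum.inr (u, false)` and `u₁ = Sum.inr (u, true)`. -/
def DoubledS (L : Type*) (U : Set L) : Type _ := {x : L // x ∉ U} ⊕ (U × Bool)

section
open Classical

/-- The order of `L[U]`. -/
noncomputable def dleS {L : Type*} [Lattice L] (U : Set L) : DoubledS L U → DoubledS L U → Prop
  | Sum.inl x, Sum.inl y => (x : L) ≤ y
  | Sum.inl x, Sum.inr ui => (x : L) ≤ (ui.1 : L)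
  | Sum.inr ui, Sum.inl y => (ui.1 : L) ≤ (y : L)
  | Sum.inr ui, Sum.inr vj =>
      if (ui.1 : L) = (vj.1 : L) then ui.2 ≤ vj.2 else (ui.1 : L) ≤ (vj.1 : L)

end

/-! ### Isolated intervals and the gluing construction -/

/-- An interval `[a, b]` is isolated if `b` covers `a` and both `a` and `b` are
doubly irreducible. -/
def Isolated {L : Type*} [Lattice L] (a b : L) : Prop :=
  a ⋖ b ∧ SupIrred a ∧ InfIrred a ∧ SupIrred b ∧ InfIrred b

/-- The underlying set of `K = L^{a,b} ⊔ F`. -/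
def Glued (L F : Type*) (a b : L) : Type _ := {x : L // x ≠ a ∧ x ≠ b} ⊕ F

/-- The order on `K = L^{a,b} ⊔ F`: on each summand the original order; and
`x < f` for `x ∈ L^{a,b}`, `f ∈ F` iff `x ≤ a`, `f < x` iff `b ≤ x`. -/
def gle {L F : Type*} [Lattice L] [Lattice F] (a b : L) :
    Glued L F a b → Glued L F a b → Prop
  | Sum.inl x, Sum.inl y => (x : L) ≤ y
  | Sum.inl x, Sum.inr _ => (x : L) ≤ a
  | Sum.inr _, Sum.inl y => b ≤ (y : L)
  | Sum.inr f, Sum.inr g => f ≤ g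


/-! ### STATEMENT 14 -/

namespace Isolated

variable {L : Type*} [Lattice L] {a b : L}

theorem le_left_of_lt_right (h : Isolated a b) {x : L} (hx : x < b) : x ≤ a := by
  obtain ⟨hab, -, -, hb, -⟩ := h
  have hle : x ⊔ a ≤ b := sup_le hx.le hab.1.le
  have hne : x ⊔ a ≠ b := fun e => (hb.2 e).elim hx.ne hab.1.ne
  by_contra hxa
  exact hab.2 (right_lt_sup.2 hxa) (lt_of_le_of_ne hle hne)

theorem right_le_of_left_lt (h : Isolated a b) {x : L} (hx : a < x) : b ≤ x := by
  obtain ⟨hab, -, ha, -, -⟩ := h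
  have hle : a ≤ x ⊓ b := le_inf hx.le hab.1.le
  have hne : x ⊓ b ≠ a := fun e => (ha.2 e).elim hx.ne' hab.1.ne'
  by_contra hbx
  exact hab.2 (lt_of_le_of_ne hle hne.symm) (inf_lt_right.2 hbx)

theorem sup_left_eq_sup_right (h : Isolated a b) {x : L} (hx : ¬ x ≤ a) : x ⊔ a = x ⊔ b :=
  le_antisymm (sup_le_sup_left h.1.le x)
    (sup_le le_sup_left (h.right_le_of_left_lt (right_lt_sup.2 hx)))

theorem inf_left_eq_inf_right (h : Isolated a b) {x : L} (hx : ¬ b ≤ x) : x ⊓ a = x ⊓ b :=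
  le_antisymm (inf_le_inf_left x h.1.le)
    (le_inf inf_le_left (h.le_left_of_lt_right (inf_lt_right.2 hx)))

theorem sup_ne (h : Isolated a b) {x y : L} (hx : x ≠ a ∧ x ≠ b) (hy : y ≠ a ∧ y ≠ b) :
    x ⊔ y ≠ a ∧ x ⊔ y ≠ b :=
  ⟨fun e => (h.2.1.2 e).elim hx.1 hy.1, fun e => (h.2.2.2.1.2 e).elim hx.2 hy.2⟩

theorem inf_ne (h : Isolated a b) {x y : L} (hx : x ≠ a ∧ x ≠ b) (hy : y ≠ a ∧ y ≠ b) :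
    x ⊓ y ≠ a ∧ x ⊓ y ≠ b :=
  ⟨fun e => (h.2.2.1.2 e).elim hx.1 hy.1, fun e => (h.2.2.2.2.2 e).elim hx.2 hy.2⟩

theorem sup_right_ne (h : Isolated a b) {x : L} (hx : x ≠ a ∧ x ≠ b) (hxa : ¬ x ≤ a) :
    x ⊔ b ≠ a ∧ x ⊔ b ≠ b :=
  ⟨fun e => hxa (e ▸ le_sup_left), fun e =>
    hxa (h.le_left_of_lt_right (lt_of_le_of_ne (sup_eq_right.1 e) hx.2))⟩

theorem inf_left_ne (h : Isolated a b) {x : L} (hx : x ≠ a ∧ x ≠ b) (hbx : ¬ b ≤ x) :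
    x ⊓ a ≠ a ∧ x ⊓ a ≠ b :=
  ⟨fun e => hbx (h.right_le_of_left_lt (lt_of_le_of_ne (inf_eq_right.1 e) hx.1.symm)),
    fun e => hbx (e ▸ inf_le_left)⟩

end Isolated

namespace Glued

variable {L F : Type*} {a b : L}

/-- The map `K → L` collapsing `F` to `a`. -/
def collapse : Glued L F a b → L
  | Sum.inl x => x
  | Sum.inr _ => a

/-- The inclusion of `L^{a,b}` in `K`. -/
def inL (x : L) (hx : x ≠ a ∧ x ≠ b) : Glued L F a b := Sum.inl ⟨x, hx⟩

/-- The inclusion of `F` in `K`. -/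
def inF (f : F) : Glued L F a b := Sum.inr f

theorem cases_inL_inF (u : Glued L F a b) : (∃ x hx, u = inL x hx) ∨ ∃ f, u = inF f := by
  rcases u with ⟨x, hx⟩ | f
  · exact Or.inl ⟨x, hx, rfl⟩
  · exact Or.inr ⟨f, rfl⟩

@[simp] theorem collapse_inL (x : L) (hx : x ≠ a ∧ x ≠ b) :
    collapse (inL x hx : Glued L F a b) = x := rfl

@[simp] theorem collapse_inF (f : F) : collapse (inF f : Glued L F a b) = a := rfl

theorem inL_ne_inF {x : L} {hx : x ≠ a ∧ x ≠ b} {f : F} :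
    (inL x hx : Glued L F a b) ≠ inF f := Sum.inl_ne_inr

theorem eq_or_of_collapse_eq {u v : Glued L F a b} (h : u.collapse = v.collapse) :
    u = v ∨ ∃ f g, u = inF f ∧ v = inF g := by
  rcases cases_inL_inF u with ⟨x, hx, rfl⟩ | ⟨f, rfl⟩ <;>
    rcases cases_inL_inF v with ⟨y, hy, rfl⟩ | ⟨g, rfl⟩
  · left
    change x = y at h
    subst h
    rfl
  · exact absurd h hx.1
  · exact absurd h.symm hy.1
  · exact Or.inr ⟨f, g, rfl, rfl⟩

variable [Lattice L] [Lattice F] [Lattice (Glued L F a b)]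

theorem inL_le_inL (hord : ∀ x y : Glued L F a b, x ≤ y ↔ gle a b x y) {x y : L}
    {hx : x ≠ a ∧ x ≠ b} {hy : y ≠ a ∧ y ≠ b} :
    (inL x hx : Glued L F a b) ≤ inL y hy ↔ x ≤ y := hord _ _

theorem inL_le_inF (hord : ∀ x y : Glued L F a b, x ≤ y ↔ gle a b x y) {x : L}
    {hx : x ≠ a ∧ x ≠ b} {f : F} : (inL x hx : Glued L F a b) ≤ inF f ↔ x ≤ a := hord _ _

theorem inF_le_inL (hord : ∀ x y : Glued L F a b, x ≤ y ↔ gle a b x y) {x : L}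
    {hx : x ≠ a ∧ x ≠ b} {f : F} : inF f ≤ (inL x hx : Glued L F a b) ↔ b ≤ x := hord _ _

theorem inF_le_inF (hord : ∀ x y : Glued L F a b, x ≤ y ↔ gle a b x y) {f g : F} :
    (inF f : Glued L F a b) ≤ inF g ↔ f ≤ g := hord _ _

theorem inL_sup_inL (hord : ∀ x y : Glued L F a b, x ≤ y ↔ gle a b x y) (h : Isolated a b) {x y : L}
    (hx : x ≠ a ∧ x ≠ b) (hy : y ≠ a ∧ y ≠ b) :
    (inL x hx ⊔ inL y hy : Glued L F a b) = inL (x ⊔ y) (h.sup_ne hx hy) := by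
  apply le_antisymm
  · exact sup_le ((inL_le_inL hord).2 le_sup_left) ((inL_le_inL hord).2 le_sup_right)
  · have hl : inL x hx ≤ inL x hx ⊔ (inL y hy : Glued L F a b) := le_sup_left
    have hr : inL y hy ≤ (inL x hx : Glued L F a b) ⊔ inL y hy := le_sup_right
    generalize (inL x hx ⊔ inL y hy : Glued L F a b) = u at hl hr ⊢
    rcases cases_inL_inF u with ⟨z, hz, rfl⟩ | ⟨f, rfl⟩
    · rw [inL_le_inL hord] at hl hr ⊢
      exact sup_le hl hr
    · rw [inL_le_inF hord] at hl hr ⊢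
      exact sup_le hl hr

theorem inL_sup_inF (hord : ∀ x y : Glued L F a b, x ≤ y ↔ gle a b x y) (h : Isolated a b) {x : L}
    (hx : x ≠ a ∧ x ≠ b) (hxa : ¬ x ≤ a) (f : F) :
    (inL x hx ⊔ inF f : Glued L F a b) = inL (x ⊔ b) (h.sup_right_ne hx hxa) := by
  apply le_antisymm
  · exact sup_le ((inL_le_inL hord).2 le_sup_left) ((inF_le_inL hord).2 le_sup_right)
  · have hl : inL x hx ≤ inL x hx ⊔ (inF f : Glued L F a b) := le_sup_left
    have hr : inF f ≤ (inL x hx : Glued L F a b) ⊔ inF f := le_sup_right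
    generalize (inL x hx ⊔ inF f : Glued L F a b) = u at hl hr ⊢
    rcases cases_inL_inF u with ⟨z, hz, rfl⟩ | ⟨g, rfl⟩
    · rw [inL_le_inL hord] at hl ⊢
      exact sup_le hl ((inF_le_inL hord).1 hr)
    · exact absurd ((inL_le_inF hord).1 hl) hxa

theorem inF_sup_inF (hord : ∀ x y : Glued L F a b, x ≤ y ↔ gle a b x y) (f g : F) :
    (inF f ⊔ inF g : Glued L F a b) = inF (f ⊔ g) := by
  apply le_antisymm
  · exact sup_le ((inF_le_inF hord).2 le_sup_left) ((inF_le_inF hord).2 le_sup_right)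
  · have hl : inF f ≤ inF f ⊔ (inF g : Glued L F a b) := le_sup_left
    have hr : inF g ≤ (inF f : Glued L F a b) ⊔ inF g := le_sup_right
    generalize (inF f ⊔ inF g : Glued L F a b) = u at hl hr ⊢
    rcases cases_inL_inF u with ⟨z, hz, rfl⟩ | ⟨k, rfl⟩
    · exact (inF_le_inL hord).2 ((inF_le_inL hord).1 hl)
    · rw [inF_le_inF hord] at hl hr ⊢
      exact sup_le hl hr

theorem inL_inf_inL (hord : ∀ x y : Glued L F a b, x ≤ y ↔ gle a b x y) (h : Isolated a b) {x y : L}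
    (hx : x ≠ a ∧ x ≠ b) (hy : y ≠ a ∧ y ≠ b) :
    (inL x hx ⊓ inL y hy : Glued L F a b) = inL (x ⊓ y) (h.inf_ne hx hy) := by
  apply le_antisymm
  · have hl : inL x hx ⊓ (inL y hy : Glued L F a b) ≤ inL x hx := inf_le_left
    have hr : (inL x hx : Glued L F a b) ⊓ inL y hy ≤ inL y hy := inf_le_right
    generalize (inL x hx ⊓ inL y hy : Glued L F a b) = u at hl hr ⊢
    rcases cases_inL_inF u with ⟨z, hz, rfl⟩ | ⟨f, rfl⟩
    · rw [inL_le_inL hord] at hl hr ⊢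
      exact le_inf hl hr
    · rw [inF_le_inL hord] at hl hr ⊢
      exact le_inf hl hr
  · exact le_inf ((inL_le_inL hord).2 inf_le_left) ((inL_le_inL hord).2 inf_le_right)

theorem inL_inf_inF (hord : ∀ x y : Glued L F a b, x ≤ y ↔ gle a b x y) (h : Isolated a b) {x : L}
    (hx : x ≠ a ∧ x ≠ b) (hbx : ¬ b ≤ x) (f : F) :
    (inL x hx ⊓ inF f : Glued L F a b) = inL (x ⊓ a) (h.inf_left_ne hx hbx) := by
  apply le_antisymm
  · have hl : inL x hx ⊓ (inF f : Glued L F a b) ≤ inL x hx := inf_le_left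
    have hr : (inL x hx : Glued L F a b) ⊓ inF f ≤ inF f := inf_le_right
    generalize (inL x hx ⊓ inF f : Glued L F a b) = u at hl hr ⊢
    rcases cases_inL_inF u with ⟨z, hz, rfl⟩ | ⟨g, rfl⟩
    · rw [inL_le_inL hord] at hl ⊢
      exact le_inf hl ((inL_le_inF hord).1 hr)
    · exact absurd ((inF_le_inL hord).1 hl) hbx
  · exact le_inf ((inL_le_inL hord).2 inf_le_left) ((inL_le_inF hord).2 inf_le_right)

theorem inF_inf_inF (hord : ∀ x y : Glued L F a b, x ≤ y ↔ gle a b x y) (f g : F) :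
    (inF f ⊓ inF g : Glued L F a b) = inF (f ⊓ g) := by
  apply le_antisymm
  · have hl : inF f ⊓ (inF g : Glued L F a b) ≤ inF f := inf_le_left
    have hr : (inF f : Glued L F a b) ⊓ inF g ≤ inF g := inf_le_right
    generalize (inF f ⊓ inF g : Glued L F a b) = u at hl hr ⊢
    rcases cases_inL_inF u with ⟨z, hz, rfl⟩ | ⟨k, rfl⟩
    · exact (inL_le_inF hord).2 ((inL_le_inF hord).1 hl)
    · rw [inF_le_inF hord] at hl hr ⊢
      exact le_inf hl hr
  · exact le_inf ((inF_le_inF hord).2 inf_le_left) ((inF_le_inF hord).2 inf_le_right)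

theorem collapse_sup (hord : ∀ x y : Glued L F a b, x ≤ y ↔ gle a b x y) (h : Isolated a b)
    (u v : Glued L F a b) : (u ⊔ v).collapse = u.collapse ⊔ v.collapse := by
  have mixed (x : L) (hx : x ≠ a ∧ x ≠ b) (f : F) :
      (inL x hx ⊔ inF f : Glued L F a b).collapse = x ⊔ a := by
    by_cases hxa : x ≤ a
    · rw [sup_eq_right.2 ((inL_le_inF hord).2 hxa), sup_eq_right.2 hxa, collapse_inF]
    · rw [inL_sup_inF hord h hx hxa, collapse_inL, h.sup_left_eq_sup_right hxa]
  rcases cases_inL_inF u with ⟨x, hx, rfl⟩ | ⟨f, rfl⟩ <;>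
    rcases cases_inL_inF v with ⟨y, hy, rfl⟩ | ⟨g, rfl⟩
  · simp [inL_sup_inL hord h]
  · exact mixed x hx g
  · rw [sup_comm, mixed y hy f, sup_comm]
    rfl
  · simp [inF_sup_inF hord]

theorem collapse_inf (hord : ∀ x y : Glued L F a b, x ≤ y ↔ gle a b x y) (h : Isolated a b)
    (u v : Glued L F a b) : (u ⊓ v).collapse = u.collapse ⊓ v.collapse := by
  have mixed (x : L) (hx : x ≠ a ∧ x ≠ b) (f : F) :
      (inL x hx ⊓ inF f : Glued L F a b).collapse = x ⊓ a := by
    by_cases hbx : b ≤ x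
    · rw [inf_eq_right.2 ((inF_le_inL hord).2 hbx), inf_eq_right.2 (h.1.le.trans hbx),
        collapse_inF]
    · rw [inL_inf_inF hord h hx hbx, collapse_inL]
  rcases cases_inL_inF u with ⟨x, hx, rfl⟩ | ⟨f, rfl⟩ <;>
    rcases cases_inL_inF v with ⟨y, hy, rfl⟩ | ⟨g, rfl⟩
  · simp [inL_inf_inL hord h]
  · exact mixed x hx g
  · rw [inf_comm, mixed y hy f, inf_comm]
    rfl
  · simp [inF_inf_inF hord]

/-- If a join lies in `F` and one of its terms does not, then the other term equals it. -/
theorem eq_of_inL_sup_eq_inF (hord : ∀ x y : Glued L F a b, x ≤ y ↔ gle a b x y) (h : Isolated a b)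
    {x : L} {hx : x ≠ a ∧ x ≠ b} {v : Glued L F a b} {f : F}
    (e : inF f = inL x hx ⊔ v) : v = inF f := by
  rcases cases_inL_inF v with ⟨y, hy, rfl⟩ | ⟨g, rfl⟩
  · rw [inL_sup_inL hord h] at e
    exact absurd e.symm inL_ne_inF
  · have hxa : x ≤ a := (inL_le_inF hord).1 (le_sup_left.trans e.ge)
    rw [e, sup_eq_right.2 ((inL_le_inF hord).2 hxa)]

/-- If a meet lies in `F` and one of its terms does not, then the other term equals it. -/
theorem eq_of_inL_inf_eq_inF (hord : ∀ x y : Glued L F a b, x ≤ y ↔ gle a b x y) (h : Isolated a b)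
    {x : L} {hx : x ≠ a ∧ x ≠ b} {v : Glued L F a b} {f : F}
    (e : inF f = inL x hx ⊓ v) : v = inF f := by
  rcases cases_inL_inF v with ⟨y, hy, rfl⟩ | ⟨g, rfl⟩
  · rw [inL_inf_inL hord h] at e
    exact absurd e.symm inL_ne_inF
  · have hbx : b ≤ x := (inF_le_inL hord).1 (e.le.trans inf_le_left)
    rw [e, inf_eq_right.2 ((inF_le_inL hord).2 hbx)]

theorem joinSD (hord : ∀ x y : Glued L F a b, x ≤ y ↔ gle a b x y) (h : Isolated a b)
    (hL : JoinSD L) (hF : JoinSD F) : JoinSD (Glued L F a b) := by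
  intro u x y z hy hz
  have hc : u.collapse = (x ⊔ (y ⊓ z)).collapse := by
    simp only [collapse_sup hord h, collapse_inf hord h]
    apply hL
    · rw [hy, collapse_sup hord h]
    · rw [hz, collapse_sup hord h]
  rcases eq_or_of_collapse_eq hc with e | ⟨f, -, rfl, -⟩
  · exact e
  rcases cases_inL_inF x with ⟨x, hx, rfl⟩ | ⟨k, rfl⟩
  · obtain rfl := eq_of_inL_sup_eq_inF hord h hy
    obtain rfl := eq_of_inL_sup_eq_inF hord h hz
    rwa [inf_idem]
  rcases cases_inL_inF y with ⟨y, hy', rfl⟩ | ⟨m, rfl⟩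
  · have hkf := eq_of_inL_sup_eq_inF hord h (hy.trans (sup_comm _ _))
    exact le_antisymm (hkf.ge.trans le_sup_left) ((sup_le_sup_left inf_le_left _).trans hy.ge)
  rcases cases_inL_inF z with ⟨z, hz', rfl⟩ | ⟨n, rfl⟩
  · have hkf := eq_of_inL_sup_eq_inF hord h (hz.trans (sup_comm _ _))
    exact le_antisymm (hkf.ge.trans le_sup_left) ((sup_le_sup_left inf_le_right _).trans hz.ge)
  rw [inF_sup_inF hord] at hy hz
  rw [inF_inf_inF hord, inF_sup_inF hord]
  exact congrArg inF (hF f k m n (Sum.inr_injective hy) (Sum.inr_injective hz))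

theorem meetSD (hord : ∀ x y : Glued L F a b, x ≤ y ↔ gle a b x y) (h : Isolated a b)
    (hL : MeetSD L) (hF : MeetSD F) : MeetSD (Glued L F a b) := by
  intro u x y z hy hz
  have hc : u.collapse = (x ⊓ (y ⊔ z)).collapse := by
    simp only [collapse_sup hord h, collapse_inf hord h]
    apply hL
    · rw [hy, collapse_inf hord h]
    · rw [hz, collapse_inf hord h]
  rcases eq_or_of_collapse_eq hc with e | ⟨f, -, rfl, -⟩
  · exact e
  rcases cases_inL_inF x with ⟨x, hx, rfl⟩ | ⟨k, rfl⟩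
  · obtain rfl := eq_of_inL_inf_eq_inF hord h hy
    obtain rfl := eq_of_inL_inf_eq_inF hord h hz
    rwa [sup_idem]
  rcases cases_inL_inF y with ⟨y, hy', rfl⟩ | ⟨m, rfl⟩
  · have hkf := eq_of_inL_inf_eq_inF hord h (hy.trans (inf_comm _ _))
    exact le_antisymm (hy.le.trans (inf_le_inf_left _ le_sup_left)) (inf_le_left.trans hkf.le)
  rcases cases_inL_inF z with ⟨z, hz', rfl⟩ | ⟨n, rfl⟩
  · have hkf := eq_of_inL_inf_eq_inF hord h (hz.trans (inf_comm _ _))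
    exact le_antisymm (hz.le.trans (inf_le_inf_left _ le_sup_right)) (inf_le_left.trans hkf.le)
  rw [inF_inf_inF hord] at hy hz
  rw [inF_sup_inF hord, inF_inf_inF hord]
  exact congrArg inF (hF f k m n (Sum.inr_injective hy) (Sum.inr_injective hz))

end Glued

/-- With `L` a finite semidistributive lattice with more than two elements having
an isolated interval `[a, b]` and `F` an FN lattice, the lattice
`K = L^{a,b} ⊔ F` (ordered by `gle a b`) is semidistributive. -/
theorem statement14 (L F : Type) [Lattice L] [Lattice F] [Finite L]
    (hL : SD L) (hcard : 2 < Nat.card L) (a b : L) (hiso : Isolated a b)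
    (hF : IsFN F)
    [instK : Lattice (Glued L F a b)]
    (hord : ∀ x y : Glued L F a b, x ≤ y ↔ gle a b x y) :
    SD (Glued L F a b) := by
  exact ⟨Glued.joinSD hord hiso hL.1 hF.2.2.1, Glued.meetSD hord hiso hL.2 hF.2.2.2⟩
end

section
/- Let L be a finite semidistributive lattice that has an isolated interval [a, b] (assuming the existence of an FN lattice, i.e., a simple, infinite, semidistributive lattice). Then the distributive lattice Con L can be represented as the congruence lattice of an infinite semidistributive lattice K; that is, there exists an infinite semidistributive lattice K with Con K ≅ Con L. -/
/-! ### Inserting fibres into a lattice -/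

/-- Data for replacing elements of a lattice `M` by pieces of a lattice `F`: the element `u` is
replaced by `F`, the elements of `[t, u)` by copies of `↓f₀` and those of `(u, s]` by copies of
`↑f₁`. -/
structure FibreData (M F : Type*) [Lattice M] [Lattice F] where
  u : M
  t : M
  s : M
  f₀ : F
  f₁ : F
  e : F
  t_le : t ≤ u
  le_s : u ≤ s
  f₀_le : f₀ ≤ e
  le_f₁ : e ≤ f₁
  prime_t : ∀ x y, x ≤ u → y ≤ u → t ≤ x ⊔ y → t ≤ x ∨ t ≤ y
  prime_s : ∀ x y, u ≤ x → u ≤ y → x ⊓ y ≤ s → x ≤ s ∨ y ≤ s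

namespace FibreData

variable {M F : Type*} [Lattice M] [Lattice F]

/-- The data on the dual lattices. -/
def dual (D : FibreData M F) : FibreData Mᵒᵈ Fᵒᵈ where
  u := OrderDual.toDual D.u
  t := OrderDual.toDual D.s
  s := OrderDual.toDual D.t
  f₀ := OrderDual.toDual D.f₁
  f₁ := OrderDual.toDual D.f₀
  e := OrderDual.toDual D.e
  t_le := D.le_s
  le_s := D.t_le
  f₀_le := D.le_f₁
  le_f₁ := D.f₀_le
  prime_t := D.prime_s
  prime_s := D.prime_t

/-- The elements of `M` that are replaced by a nontrivial part of `F`. -/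
def Thick (D : FibreData M F) (x : M) : Prop := (D.t ≤ x ∧ x ≤ D.u) ∨ (D.u ≤ x ∧ x ≤ D.s)

open Classical in
/-- The second coordinate of an element whose fibre is a single point. -/
noncomputable def defaultCoord (D : FibreData M F) (x : M) : F :=
  if x < D.u then D.f₀ else if D.u < x then D.f₁ else D.e

/-- The elements of the lattice obtained by inserting the fibres. -/
@[ext]
structure Pt (D : FibreData M F) where
  x : M
  f : F
  low : x < D.u → f ≤ D.f₀
  high : D.u < x → D.f₁ ≤ f
  thin : ¬ D.Thick x → f = D.defaultCoord x

variable {D : FibreData M F}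

theorem f₀_le_f₁ (D : FibreData M F) : D.f₀ ≤ D.f₁ := D.f₀_le.trans D.le_f₁

theorem defaultCoord_le (D : FibreData M F) (x : M) : D.defaultCoord x ≤ D.f₁ := by
  unfold defaultCoord
  split_ifs
  exacts [D.f₀_le_f₁, le_rfl, D.le_f₁]

theorem defaultCoord_of_lt {x : M} (h : x < D.u) : D.defaultCoord x = D.f₀ := if_pos h

theorem defaultCoord_of_gt {x : M} (h : D.u < x) : D.defaultCoord x = D.f₁ := by
  rw [defaultCoord, if_neg h.not_gt, if_pos h]

theorem defaultCoord_of_not {x : M} (h : ¬ x < D.u) (h' : ¬ D.u < x) :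
    D.defaultCoord x = D.e := by
  rw [defaultCoord, if_neg h, if_neg h']

theorem thick_iff_of_le {x : M} (h : x ≤ D.u) : D.Thick x ↔ D.t ≤ x :=
  ⟨fun h' => h'.elim And.left fun h'' => D.t_le.trans h''.1, fun h' => Or.inl ⟨h', h⟩⟩

theorem thick_iff_of_ge {x : M} (h : D.u ≤ x) : D.Thick x ↔ x ≤ D.s :=
  ⟨fun h' => h'.elim (fun h'' => h''.2.trans D.le_s) And.right, fun h' => Or.inr ⟨h, h'⟩⟩

instance : LE (Pt D) := ⟨fun X Y => X.x ≤ Y.x ∧ (D.Thick X.x → D.Thick Y.x → X.f ≤ Y.f)⟩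

instance : PartialOrder (Pt D) where
  le_refl X := ⟨le_rfl, fun _ _ => le_rfl⟩
  le_trans X Y Z h h' := by
    refine ⟨h.1.trans h'.1, fun hX hZ => ?_⟩
    by_cases hY : D.Thick Y.x
    · exact (h.2 hX hY).trans (h'.2 hY hZ)
    · have hxy := h.1
      have hyz := h'.1
      rcases hX with hX | hX
      · rcases hZ with hZ | hZ
        · exact absurd (Or.inl ⟨hX.1.trans hxy, hyz.trans hZ.2⟩) hY
        · have h1 : X.x < D.u := lt_of_le_of_ne hX.2 fun h0 =>
            hY (Or.inr ⟨h0 ▸ hxy, hyz.trans hZ.2⟩)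
          have h2 : D.u < Z.x := lt_of_le_of_ne hZ.1 fun h0 =>
            hY (Or.inl ⟨hX.1.trans hxy, h0 ▸ hyz⟩)
          exact (X.low h1).trans (D.f₀_le_f₁.trans (Z.high h2))
      · rcases hZ with hZ | hZ
        · have : X.x = D.u := le_antisymm (hxy.trans (hyz.trans hZ.2)) hX.1
          exact absurd (Or.inl ⟨D.t_le.trans (hX.1.trans hxy), hyz.trans hZ.2⟩) hY
        · exact absurd (Or.inr ⟨hX.1.trans hxy, hyz.trans hZ.2⟩) hY
  le_antisymm X Y h h' := by
    have hx := le_antisymm h.1 h'.1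
    refine Pt.ext hx ?_
    by_cases hX : D.Thick X.x
    · have hY : D.Thick Y.x := hx ▸ hX
      exact le_antisymm (h.2 hX hY) (h'.2 hY hX)
    · have hY : ¬ D.Thick Y.x := hx ▸ hX
      rw [X.thin hX, Y.thin hY, hx]

open Classical in
/-- The second coordinate of a join. -/
noncomputable def supCoord (X Y : Pt D) : F :=
  if X.x ⊔ Y.x ≤ D.u ∧ D.t ≤ X.x ⊔ Y.x then
    if D.t ≤ X.x then if D.t ≤ Y.x then X.f ⊔ Y.f else X.f else Y.f
  else if D.u < X.x ⊔ Y.x ∧ X.x ⊔ Y.x ≤ D.s then D.f₁ ⊔ X.f ⊔ Y.f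
  else D.defaultCoord (X.x ⊔ Y.x)

theorem Pt.f_le_of_le {X Z : Pt D} (h : X ≤ Z) (hZ : D.Thick Z.x) (hu : D.u < Z.x) :
    X.f ≤ Z.f := by
  by_cases hX : D.Thick X.x
  · exact h.2 hX hZ
  · rw [X.thin hX]
    exact (D.defaultCoord_le _).trans (Z.high hu)

/-- The join of two elements. -/
noncomputable def Pt.sup (X Y : Pt D) : Pt D where
  x := X.x ⊔ Y.x
  f := supCoord X Y
  low h := by
    have hx := lt_of_le_of_lt le_sup_left h
    have hy := lt_of_le_of_lt le_sup_right h
    unfold supCoord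
    split_ifs
    · exact sup_le (X.low hx) (Y.low hy)
    · exact X.low hx
    · exact Y.low hy
    · exact absurd h (by rename_i h'; exact h'.1.not_gt)
    · exact (defaultCoord_of_lt h).le
  high h := by
    unfold supCoord
    rw [if_neg fun h' => h'.1.not_gt h]
    split_ifs
    · exact le_sup_left.trans le_sup_left
    · exact (defaultCoord_of_gt h).ge
  thin h := by
    unfold supCoord
    rw [if_neg fun h' => h (Or.inl h'.symm), if_neg fun h' => h (Or.inr ⟨h'.1.le, h'.2⟩)]

theorem Pt.sup_comm' (X Y : Pt D) : X.sup Y = Y.sup X := by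
  refine Pt.ext (sup_comm _ _) ?_
  change supCoord X Y = supCoord Y X
  unfold supCoord
  rw [sup_comm X.x Y.x, sup_comm X.f Y.f, sup_assoc, sup_comm X.f Y.f, ← sup_assoc]
  split_ifs with h h1 h2 h2 <;> try rfl
  rcases D.prime_t _ _ (le_sup_left.trans h.1) (le_sup_right.trans h.1) h.2 with h3 | h3
  exacts [absurd h3 h2, absurd h3 h1]

theorem Pt.le_sup (X Y : Pt D) : X ≤ X.sup Y := by
  refine ⟨le_sup_left, fun hX hW => ?_⟩
  change X.f ≤ supCoord X Y
  change D.Thick (X.x ⊔ Y.x) at hW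
  unfold supCoord
  split_ifs with h1 h2 h3 h4
  · exact le_sup_left
  · exact le_rfl
  · exact absurd ((thick_iff_of_le (le_sup_left.trans h1.1)).1 hX) h2
  · exact le_sup_right.trans le_sup_left
  · rcases hW with hW | hW
    · exact absurd hW.symm h1
    · refine absurd ⟨lt_of_le_of_ne hW.1 fun h => h1 ⟨h.ge, h ▸ D.t_le⟩, hW.2⟩ h4

theorem Pt.sup_le' {X Y Z : Pt D} (hX : X ≤ Z) (hY : Y ≤ Z) : X.sup Y ≤ Z := by
  refine ⟨sup_le hX.1 hY.1, fun hW hZ => ?_⟩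
  change supCoord X Y ≤ Z.f
  change D.Thick (X.x ⊔ Y.x) at hW
  unfold supCoord
  split_ifs with h1 h2 h3 h4
  · exact sup_le (hX.2 (Or.inl ⟨h2, le_sup_left.trans h1.1⟩) hZ)
      (hY.2 (Or.inl ⟨h3, le_sup_right.trans h1.1⟩) hZ)
  · exact hX.2 (Or.inl ⟨h2, le_sup_left.trans h1.1⟩) hZ
  · have h3 := (D.prime_t _ _ (le_sup_left.trans h1.1) (le_sup_right.trans h1.1) h1.2).resolve_left
      h2
    exact hY.2 (Or.inl ⟨h3, le_sup_right.trans h1.1⟩) hZ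
  · have hu : D.u < Z.x := h4.1.trans_le (sup_le hX.1 hY.1)
    exact sup_le (sup_le (Z.high hu) (Pt.f_le_of_le hX hZ hu)) (Pt.f_le_of_le hY hZ hu)
  · rcases hW with hW | hW
    · exact absurd hW.symm h1
    · refine absurd ⟨lt_of_le_of_ne hW.1 fun h => h1 ⟨h.ge, h ▸ D.t_le⟩, hW.2⟩ h4

theorem thick_dual {x : M} : D.dual.Thick (OrderDual.toDual x) ↔ D.Thick x :=
  ⟨fun h => h.elim (fun h => Or.inr ⟨h.2, h.1⟩) fun h => Or.inl ⟨h.2, h.1⟩,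
    fun h => h.elim (fun h => Or.inr ⟨h.2, h.1⟩) fun h => Or.inl ⟨h.2, h.1⟩⟩

theorem defaultCoord_dual (x : M) :
    D.dual.defaultCoord (OrderDual.toDual x) = OrderDual.toDual (D.defaultCoord x) := by
  by_cases h : x < D.u
  · rw [defaultCoord_of_lt h]
    exact defaultCoord_of_gt (D := D.dual) h
  · by_cases h' : D.u < x
    · rw [defaultCoord_of_gt h']
      exact defaultCoord_of_lt (D := D.dual) h'
    · rw [defaultCoord_of_not h h']
      exact defaultCoord_of_not (D := D.dual) h' h

/-- The construction commutes with order duality. -/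
def Pt.dual : Pt D ≃ Pt D.dual where
  toFun X :=
    { x := OrderDual.toDual X.x
      f := OrderDual.toDual X.f
      low := X.high
      high := X.low
      thin := fun h => by
        rw [defaultCoord_dual, X.thin fun h' => h (thick_dual.2 h')] }
  invFun X :=
    { x := OrderDual.ofDual X.x
      f := OrderDual.ofDual X.f
      low := X.high
      high := X.low
      thin := fun h => by
        rw [X.thin fun h' => h (thick_dual.1 h')]
        exact congrArg OrderDual.ofDual (defaultCoord_dual _) }
  left_inv _ := rfl
  right_inv _ := rfl

theorem Pt.dual_le_dual {X Y : Pt D} : Pt.dual X ≤ Pt.dual Y ↔ Y ≤ X :=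
  ⟨fun h => ⟨h.1, fun h1 h2 => h.2 (thick_dual.2 h2) (thick_dual.2 h1)⟩,
    fun h => ⟨h.1, fun h1 h2 => h.2 (thick_dual.1 h2) (thick_dual.1 h1)⟩⟩

noncomputable instance : Lattice (Pt D) where
  sup := Pt.sup
  le_sup_left := Pt.le_sup
  le_sup_right X Y := Pt.sup_comm' Y X ▸ Pt.le_sup Y X
  sup_le _ _ _ := Pt.sup_le'
  inf X Y := Pt.dual.symm (Pt.sup (Pt.dual X) (Pt.dual Y))
  inf_le_left X Y := Pt.dual_le_dual.1 (Pt.le_sup (Pt.dual X) (Pt.dual Y))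
  inf_le_right X Y := Pt.dual_le_dual.1
    (Pt.sup_comm' (Pt.dual Y) (Pt.dual X) ▸ Pt.le_sup (Pt.dual Y) (Pt.dual X))
  le_inf _ _ _ h h' := Pt.dual_le_dual.1
    (Pt.sup_le' (Pt.dual_le_dual.2 h) (Pt.dual_le_dual.2 h'))

theorem Pt.dual_inf (X Y : Pt D) : Pt.dual (X ⊓ Y) = Pt.dual X ⊔ Pt.dual Y := rfl

theorem Pt.dual_sup (X Y : Pt D) : Pt.dual (X ⊔ Y) = Pt.dual X ⊓ Pt.dual Y := by
  refine le_antisymm (le_inf (Pt.dual_le_dual.2 le_sup_left) (Pt.dual_le_dual.2 le_sup_right)) ?_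
  obtain ⟨Z, hZ⟩ := Pt.dual.surjective (Pt.dual X ⊓ Pt.dual Y)
  rw [← hZ, Pt.dual_le_dual]
  exact sup_le (Pt.dual_le_dual.1 (hZ ▸ inf_le_left)) (Pt.dual_le_dual.1 (hZ ▸ inf_le_right))

theorem Pt.sup_x (X Y : Pt D) : (X ⊔ Y).x = X.x ⊔ Y.x := rfl

theorem Pt.inf_x (X Y : Pt D) : (X ⊓ Y).x = X.x ⊓ Y.x := rfl

theorem Pt.sup_f (X Y : Pt D) : (X ⊔ Y).f = supCoord X Y := rfl

theorem Pt.sup_f_of_le {X Y : Pt D} (h : X.x ⊔ Y.x ≤ D.u) (hx : D.t ≤ X.x) (hy : D.t ≤ Y.x) :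
    (X ⊔ Y).f = X.f ⊔ Y.f := by
  rw [Pt.sup_f, supCoord, if_pos ⟨h, hx.trans le_sup_left⟩, if_pos hx, if_pos hy]

theorem Pt.sup_f_of_le_left {X Y : Pt D} (h : X.x ⊔ Y.x ≤ D.u) (hx : D.t ≤ X.x)
    (hy : ¬ D.t ≤ Y.x) : (X ⊔ Y).f = X.f := by
  rw [Pt.sup_f, supCoord, if_pos ⟨h, hx.trans le_sup_left⟩, if_pos hx, if_neg hy]

theorem Pt.sup_f_of_le_right {X Y : Pt D} (h : X.x ⊔ Y.x ≤ D.u) (hx : ¬ D.t ≤ X.x)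
    (hy : D.t ≤ Y.x) : (X ⊔ Y).f = Y.f := by
  rw [Pt.sup_f, supCoord, if_pos ⟨h, hy.trans le_sup_right⟩, if_neg hx]

theorem Pt.sup_f_of_gt {X Y : Pt D} (h : D.u < X.x ⊔ Y.x) (hs : X.x ⊔ Y.x ≤ D.s) :
    (X ⊔ Y).f = D.f₁ ⊔ X.f ⊔ Y.f := by
  rw [Pt.sup_f, supCoord, if_neg fun h' => h'.1.not_gt h, if_pos ⟨h, hs⟩]

theorem Pt.inf_f_of_ge {X Y : Pt D} (h : D.u ≤ X.x ⊓ Y.x) (hx : X.x ≤ D.s) (hy : Y.x ≤ D.s) :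
    (X ⊓ Y).f = X.f ⊓ Y.f :=
  Pt.sup_f_of_le (X := Pt.dual X) (Y := Pt.dual Y) h hx hy

theorem Pt.inf_f_of_lt {X Y : Pt D} (h : X.x ⊓ Y.x < D.u) (ht : D.t ≤ X.x ⊓ Y.x) :
    (X ⊓ Y).f = D.f₀ ⊓ X.f ⊓ Y.f :=
  Pt.sup_f_of_gt (X := Pt.dual X) (Y := Pt.dual Y) h ht

theorem Pt.eq_of_not_thick {X Y : Pt D} (h : X.x = Y.x) (hX : ¬ D.Thick X.x) : X = Y :=
  Pt.ext h (by rw [X.thin hX, Y.thin (h ▸ hX), h])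

theorem Pt.inf_f_of_le {X Y : Pt D} (hx : X.x ≤ D.u) (hy : Y.x ≤ D.u) (ht : D.t ≤ X.x ⊓ Y.x) :
    (X ⊓ Y).f = X.f ⊓ Y.f := by
  by_cases h : X.x ⊓ Y.x < D.u
  · rw [Pt.inf_f_of_lt h ht, inf_assoc, inf_eq_right]
    by_cases hxu : X.x = D.u
    · have hyu : Y.x < D.u := lt_of_le_of_ne hy fun hyu => by simp [hxu, hyu] at h
      exact inf_le_right.trans (Y.low hyu)
    · exact inf_le_left.trans (X.low (lt_of_le_of_ne hx hxu))
  · have h' : X.x ⊓ Y.x = D.u := eq_of_le_of_not_lt (inf_le_left.trans hx) h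
    exact Pt.inf_f_of_ge h'.ge (hx.trans D.le_s) (hy.trans D.le_s)

theorem joinSD_pt (hM : JoinSD M) (hF : JoinSD F) : JoinSD (Pt D) := by
  intro U X Y Z hY hZ
  have hw : X.x ⊔ Y.x = X.x ⊔ (Y.x ⊓ Z.x) :=
    hM _ _ _ _ rfl (congrArg Pt.x (hY.symm.trans hZ))
  have hyz : X.x ⊔ Y.x = X.x ⊔ Z.x := congrArg Pt.x (hY.symm.trans hZ)
  have hf : (X ⊔ Y).f = (X ⊔ Z).f := congrArg Pt.f (hY.symm.trans hZ)
  rw [hY]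
  by_cases hthick : D.Thick (X ⊔ Y).x
  swap
  · exact Pt.eq_of_not_thick hw hthick
  refine Pt.ext hw ?_
  by_cases hu : X.x ⊔ Y.x ≤ D.u
  · have ht : D.t ≤ X.x ⊔ Y.x := (thick_iff_of_le hu).1 hthick
    have hxu := le_sup_left.trans hu
    have hyu := le_sup_right.trans hu
    have hu' := hyz ▸ hu
    have hzu := le_sup_right.trans hu'
    have hyzu : X.x ⊔ (Y ⊓ Z).x ≤ D.u := by rw [Pt.inf_x, ← hw]; exact hu
    by_cases hx : D.t ≤ X.x
    · by_cases hy : D.t ≤ Y.x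
      · by_cases hz : D.t ≤ Z.x
        · rw [Pt.sup_f_of_le hu hx hy, Pt.sup_f_of_le hu' hx hz] at hf
          rw [Pt.sup_f_of_le hu hx hy, Pt.sup_f_of_le hyzu hx (le_inf hy hz),
            Pt.inf_f_of_le hyu hzu (le_inf hy hz)]
          exact hF _ _ _ _ rfl hf
        · rw [hf, Pt.sup_f_of_le_left hu' hx hz,
            Pt.sup_f_of_le_left hyzu hx fun h => hz (h.trans inf_le_right)]
      · rw [Pt.sup_f_of_le_left hu hx hy,
          Pt.sup_f_of_le_left hyzu hx fun h => hy (h.trans inf_le_left)]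
    · have hy := (D.prime_t _ _ hxu hyu ht).resolve_left hx
      have hz := (D.prime_t _ _ hxu hzu (hyz ▸ ht)).resolve_left hx
      rw [Pt.sup_f_of_le_right hu hx hy, Pt.sup_f_of_le_right hu' hx hz] at hf
      rw [Pt.sup_f_of_le_right hu hx hy, Pt.sup_f_of_le_right hyzu hx (le_inf hy hz),
        Pt.inf_f_of_le hyu hzu (le_inf hy hz), hf, inf_idem]
  · obtain ⟨hu, hs⟩ : D.u < X.x ⊔ Y.x ∧ X.x ⊔ Y.x ≤ D.s := by
      rcases hthick with h | h
      · exact absurd h.2 hu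
      · exact ⟨lt_of_le_of_ne h.1 fun h' => hu h'.ge, h.2⟩
    have hu' := hyz ▸ hu
    have hs' := hyz ▸ hs
    have huw : D.u < X.x ⊔ (Y ⊓ Z).x := by rw [Pt.inf_x, ← hw]; exact hu
    have hsw : X.x ⊔ (Y ⊓ Z).x ≤ D.s := by rw [Pt.inf_x, ← hw]; exact hs
    refine le_antisymm ?_ ((show X ⊔ (Y ⊓ Z) ≤ X ⊔ Y from
      sup_le_sup_left inf_le_left X).2 (Or.inr ⟨huw.le, hsw⟩) hthick)
    rw [Pt.sup_f_of_gt hu hs, Pt.sup_f_of_gt hu' hs'] at hf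
    rw [Pt.sup_f_of_gt hu hs, Pt.sup_f_of_gt huw hsw]
    have small : ∀ V : Pt D, ¬ (D.u ≤ V.x ∧ V.x ≤ D.s) → V.f ≤ D.f₁ := by
      intro V hV
      by_cases hV' : D.Thick V.x
      · rcases hV' with h | h
        · exact (V.low (lt_of_le_of_ne h.2 fun h' =>
            hV ⟨h'.ge, h'.le.trans D.le_s⟩)).trans D.f₀_le_f₁
        · exact absurd h hV
      · rw [V.thin hV']
        exact D.defaultCoord_le _
    by_cases hy : D.u ≤ Y.x ∧ Y.x ≤ D.s
    · by_cases hz : D.u ≤ Z.x ∧ Z.x ≤ D.s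
      · rw [Pt.inf_f_of_ge (le_inf hy.1 hz.1) hy.2 hz.2]
        exact (hF _ _ _ _ rfl hf).le
      · rw [hf]
        exact sup_le le_sup_left ((small Z hz).trans (le_sup_left.trans le_sup_left))
    · exact sup_le le_sup_left ((small Y hy).trans (le_sup_left.trans le_sup_left))

theorem meetSD_pt (hM : MeetSD M) (hF : MeetSD F) : MeetSD (Pt D) := by
  intro W X Y Z hY hZ
  have hM' : JoinSD Mᵒᵈ := hM
  have hF' : JoinSD Fᵒᵈ := hF
  apply Pt.dual.injective
  rw [Pt.dual_inf, Pt.dual_sup]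
  exact joinSD_pt (D := D.dual) hM' hF' _ _ _ _ (by rw [hY, Pt.dual_inf]) (by rw [hZ, Pt.dual_inf])

end FibreData

namespace LatCon

variable {L : Type*} [Lattice L]

/-- A congruence from an equivalence relation compatible with one-sided joins and meets. -/
def ofOneSided (r : L → L → Prop) (refl : ∀ x, r x x) (symm : ∀ {x y}, r x y → r y x)
    (trans : ∀ {x y z}, r x y → r y z → r x z)
    (sup : ∀ {x y} z, r x y → r (x ⊔ z) (y ⊔ z))
    (inf : ∀ {x y} z, r x y → r (x ⊓ z) (y ⊓ z)) : LatCon L where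
  r := r
  refl' := refl
  symm' := symm
  trans' := trans
  sup' {x y x' y'} h h' := trans (sup x' h) (by
    rw [sup_comm y x', sup_comm y y']
    exact sup y h')
  inf' {x y x' y'} h h' := trans (inf x' h) (by
    rw [inf_comm y x', inf_comm y y']
    exact inf y h')

/-- The same relation as a congruence of the dual lattice. -/
def dual (c : LatCon L) : LatCon Lᵒᵈ where
  r x y := c.r (OrderDual.ofDual x) (OrderDual.ofDual y)
  refl' _ := c.refl' _
  symm' := c.symm'
  trans' := c.trans'
  sup' := c.inf'
  inf' := c.sup'

/-- The preimage of a congruence under a lattice homomorphism. -/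
def comap {K : Type*} [Lattice K] (j : L → K) (hs : ∀ x y, j (x ⊔ y) = j x ⊔ j y)
    (hi : ∀ x y, j (x ⊓ y) = j x ⊓ j y) (c : LatCon K) : LatCon L where
  r x y := c.r (j x) (j y)
  refl' _ := c.refl' _
  symm' := c.symm'
  trans' := c.trans'
  sup' h h' := by
    rw [hs, hs]
    exact c.sup' h h'
  inf' h h' := by
    rw [hi, hi]
    exact c.inf' h h'

theorem sup_right (c : LatCon L) {x y : L} (h : c.r x y) (z : L) : c.r (x ⊔ z) (y ⊔ z) :=
  c.sup' h (c.refl' z)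

theorem inf_right (c : LatCon L) {x y : L} (h : c.r x y) (z : L) : c.r (x ⊓ z) (y ⊓ z) :=
  c.inf' h (c.refl' z)

theorem inf_rel_sup (c : LatCon L) {x y : L} (h : c.r x y) : c.r (x ⊓ y) (x ⊔ y) := by
  have h1 := c.inf_right h y
  have h2 := c.sup_right h y
  rw [inf_idem] at h1
  rw [sup_idem] at h2
  exact c.trans' h1 (c.symm' h2)

theorem rel_of_inf_rel_sup (c : LatCon L) {x y : L} (h : c.r (x ⊓ y) (x ⊔ y)) : c.r x y := by
  have h1 := c.sup_right h x
  have h2 := c.sup_right h y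
  rw [sup_eq_right.2 inf_le_left, sup_eq_left.2 le_sup_left] at h1
  rw [sup_eq_right.2 inf_le_right, sup_eq_left.2 le_sup_right] at h2
  exact c.trans' h1 (c.symm' h2)

end LatCon

namespace FibreData

variable {M F : Type*} [Lattice M] [Lattice F] {D : FibreData M F}

/-- The copy of `F` that replaces `u`. -/
def mid (D : FibreData M F) (f : F) : Pt D where
  x := D.u
  f := f
  low h := absurd h (lt_irrefl _)
  high h := absurd h (lt_irrefl _)
  thin h := absurd (Or.inl ⟨D.t_le, le_rfl⟩) h

theorem sup_mid {X : Pt D} (hu : X.x ≤ D.u) (ht : D.t ≤ X.x) (h : F) :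
    X ⊔ D.mid h = D.mid (X.f ⊔ h) :=
  Pt.ext (sup_eq_right.2 hu) (Pt.sup_f_of_le (sup_le hu le_rfl) ht D.t_le)

theorem mid_sup (f g : F) : D.mid (f ⊔ g) = D.mid f ⊔ D.mid g :=
  (sup_mid (X := D.mid f) le_rfl D.t_le g).symm

theorem mid_inf (f g : F) : D.mid (f ⊓ g) = D.mid f ⊓ D.mid g :=
  Pt.dual.injective (mid_sup (D := D.dual) (OrderDual.toDual f) (OrderDual.toDual g))

theorem mid_le_mid {f g : F} (h : f ≤ g) : D.mid f ≤ D.mid g := ⟨le_rfl, fun _ _ => h⟩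

theorem mid_le_of_gt {f : F} {X : Pt D} (hX : D.u < X.x) (hf : f ≤ D.f₁) : D.mid f ≤ X :=
  ⟨hX.le, fun _ _ => hf.trans (X.high hX)⟩

theorem le_mid_of_lt {f : F} {X : Pt D} (hX : X.x < D.u) (hf : D.f₀ ≤ f) : X ≤ D.mid f :=
  ⟨hX.le, fun _ _ => (X.low hX).trans hf⟩

theorem inf_mid_eq {X Y : Pt D} (hu : X.x ≤ D.u) (ht : D.t ≤ X.x) (hxy : X.x = Y.x) :
    (X ⊔ Y) ⊓ D.mid X.f = X := by
  have hsup : X.x ⊔ Y.x = X.x := sup_eq_left.2 hxy.ge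
  have hle : (X ⊔ Y).x ≤ D.u := hsup.le.trans hu
  have hx : (X ⊔ Y).x ⊓ D.u = X.x := by rw [Pt.sup_x, hsup, inf_eq_left.2 hu]
  refine Pt.ext hx ?_
  rw [Pt.inf_f_of_le hle le_rfl (hx ▸ ht), Pt.sup_f_of_le hle ht (hxy ▸ ht)]
  exact inf_eq_right.2 le_sup_left

namespace Pt

/-- A congruence of `Pt D` as a congruence of `Pt D.dual`. -/
def conDual (c : LatCon (Pt D)) : LatCon (Pt D.dual) where
  r X Y := c.r (Pt.dual.symm X) (Pt.dual.symm Y)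
  refl' _ := c.refl' _
  symm' := c.symm'
  trans' := c.trans'
  sup' {X Y X' Y'} := by
    obtain ⟨X, rfl⟩ := Pt.dual.surjective X
    obtain ⟨Y, rfl⟩ := Pt.dual.surjective Y
    obtain ⟨X', rfl⟩ := Pt.dual.surjective X'
    obtain ⟨Y', rfl⟩ := Pt.dual.surjective Y'
    exact c.inf'
  inf' {X Y X' Y'} := by
    obtain ⟨X, rfl⟩ := Pt.dual.surjective X
    obtain ⟨Y, rfl⟩ := Pt.dual.surjective Y
    obtain ⟨X', rfl⟩ := Pt.dual.surjective X'
    obtain ⟨Y', rfl⟩ := Pt.dual.surjective Y'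
    rw [← Pt.dual_sup, ← Pt.dual_sup]
    exact c.sup'

end Pt

/-- The congruence `c` identifies all elements of the copy of `F` that replaces `u`. -/
def Collapses (c : LatCon (Pt D)) : Prop := ∀ f g, c.r (D.mid f) (D.mid g)

theorem collapses_conDual {c : LatCon (Pt D)} : Collapses (Pt.conDual c) ↔ Collapses c := Iff.rfl

theorem collapses_of_mid (hF : IsSimpleLat F) {c : LatCon (Pt D)} {f g : F} (hne : f ≠ g)
    (h : c.r (D.mid f) (D.mid g)) : Collapses c := by
  rcases hF.2 (c.comap D.mid mid_sup mid_inf) with h' | h'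
  · exact absurd (show (⊥ : LatCon F).r f g from h' ▸ h) hne
  · intro f' g'
    have : (c.comap D.mid mid_sup mid_inf).r f' g' := h' ▸ trivial
    exact this

theorem collapses_of_le (hF : IsSimpleLat F) {c : LatCon (Pt D)} {X Y : Pt D} (hx : X.x = Y.x)
    (hu : X.x ≤ D.u) (hf : X.f ≠ Y.f) (h : c.r X Y) : Collapses c := by
  have ht : D.t ≤ X.x := by
    by_contra ht
    exact hf (congrArg Pt.f (Pt.eq_of_not_thick hx fun h => ht ((thick_iff_of_le hu).1 h)))
  have := c.sup_right h (D.mid (X.f ⊓ Y.f))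
  rw [sup_mid hu ht, sup_mid (hx ▸ hu) (hx ▸ ht), sup_eq_left.2 inf_le_left,
    sup_eq_left.2 inf_le_right] at this
  exact collapses_of_mid hF hf this

theorem isSimpleLat_dual (hF : IsSimpleLat F) : IsSimpleLat Fᵒᵈ := by
  refine ⟨hF.1, fun c => ?_⟩
  rcases hF.2 (LatCon.dual c) with h | h
  · left
    ext x y
    exact Iff.of_eq (congrArg (fun e : LatCon F => e.r x y) h)
  · right
    ext x y
    exact Iff.of_eq (congrArg (fun e : LatCon F => e.r x y) h)

theorem collapses_of_rel (hF : IsSimpleLat F) {c : LatCon (Pt D)} {X Y : Pt D} (hx : X.x = Y.x)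
    (hf : X.f ≠ Y.f) (h : c.r X Y) : Collapses c := by
  by_cases ht : D.Thick X.x
  · rcases ht with ht | ht
    · exact collapses_of_le hF hx ht.2 hf h
    · exact collapses_conDual.1 (collapses_of_le (isSimpleLat_dual hF) (c := Pt.conDual c)
        (X := Pt.dual X) (Y := Pt.dual Y) hx ht.1 hf h)
  · exact absurd (congrArg Pt.f (Pt.eq_of_not_thick hx ht)) hf

theorem Collapses.rel_of_le {c : LatCon (Pt D)} (hc : Collapses c) {X Y : Pt D} (hx : X.x = Y.x)
    (hu : X.x ≤ D.u) (ht : D.t ≤ X.x) : c.r X Y := by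
  have := c.inf' (c.refl' (X ⊔ Y)) (hc X.f Y.f)
  rw [inf_mid_eq hu ht hx, sup_comm, inf_mid_eq (hx ▸ hu) (hx ▸ ht) hx.symm] at this
  exact this

theorem Collapses.rel {c : LatCon (Pt D)} (hc : Collapses c) {X Y : Pt D} (hx : X.x = Y.x) :
    c.r X Y := by
  by_cases ht : D.Thick X.x
  · rcases ht with ht | ht
    · exact hc.rel_of_le hx ht.2 ht.1
    · exact Collapses.rel_of_le (collapses_conDual.2 hc) (X := Pt.dual X) (Y := Pt.dual Y)
        hx ht.1 ht.2
  · rw [Pt.eq_of_not_thick hx ht]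
    exact c.refl' _

/-- A lattice `L` mapping onto `M` such that the only nontrivial fibre is `{a, b}`, over `u`. -/
structure Cover (D : FibreData M F) (L : Type*) [Lattice L] where
  proj : L → M
  a : L
  b : L
  map_sup : ∀ x y, proj (x ⊔ y) = proj x ⊔ proj y
  map_inf : ∀ x y, proj (x ⊓ y) = proj x ⊓ proj y
  surj : ∀ m, ∃ x, proj x = m
  proj_a : proj a = D.u
  proj_b : proj b = D.u
  eq_or : ∀ x y, proj x = proj y → x = y ∨ (x = a ∧ y = b) ∨ (x = b ∧ y = a)
  a_lt : a < b
  f_lt : D.f₀ < D.f₁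
  stable_t : ∀ d : LatCon L, ¬ d.r a b → ∀ x y, x ≤ a → y ≤ a → d.r x y →
    D.t ≤ proj x → D.t ≤ proj y
  stable_s : ∀ d : LatCon L, ¬ d.r a b → ∀ x y, b ≤ x → b ≤ y → d.r x y →
    proj x ≤ D.s → proj y ≤ D.s

namespace Cover

variable {L : Type*} [Lattice L] (C : Cover D L)

/-- The cover of the dual lattices. -/
def dual : Cover D.dual Lᵒᵈ where
  proj x := OrderDual.toDual (C.proj (OrderDual.ofDual x))
  a := OrderDual.toDual C.b
  b := OrderDual.toDual C.a
  map_sup := C.map_inf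
  map_inf := C.map_sup
  surj := C.surj
  proj_a := C.proj_b
  proj_b := C.proj_a
  eq_or x y h := (C.eq_or x y h).imp_right Or.symm
  a_lt := C.a_lt
  f_lt := C.f_lt
  stable_t d h := C.stable_s (LatCon.dual d) fun h' => h (d.symm' h')
  stable_s d h := C.stable_t (LatCon.dual d) fun h' => h (d.symm' h')

theorem proj_mono {x y : L} (h : x ≤ y) : C.proj x ≤ C.proj y := by
  rw [← sup_eq_right, ← C.map_sup, sup_eq_right.2 h]

theorem proj_le {x : L} : C.proj x ≤ D.u ↔ x ≤ C.a ∨ x = C.b := by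
  constructor
  · intro h
    have h' : C.proj (x ⊓ C.a) = C.proj x := by rw [C.map_inf, C.proj_a, inf_eq_left.2 h]
    rcases C.eq_or _ _ h' with h1 | h1 | h1
    · exact Or.inl (inf_eq_left.1 h1)
    · exact Or.inr h1.2
    · exact absurd (h1.1 ▸ inf_le_right : C.b ≤ C.a) C.a_lt.not_ge
  · rintro (h | rfl)
    · exact C.proj_a ▸ C.proj_mono h
    · exact C.proj_b.le

theorem le_proj {x : L} : D.u ≤ C.proj x ↔ C.b ≤ x ∨ x = C.a := C.dual.proj_le

theorem le_a_of_lt {x : L} (h : C.proj x < D.u) : x ≤ C.a :=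
  (C.proj_le.1 h.le).resolve_right fun h' => h.ne (h' ▸ C.proj_b)

theorem b_le_of_gt {x : L} (h : D.u < C.proj x) : C.b ≤ x := C.dual.le_a_of_lt h

theorem exists_low {m : M} (h : m ≤ D.u) : ∃ x, x ≤ C.a ∧ C.proj x = m := by
  obtain ⟨x, rfl⟩ := C.surj m
  rcases C.proj_le.1 h with h | rfl
  · exact ⟨x, h, rfl⟩
  · exact ⟨C.a, le_rfl, C.proj_a.trans C.proj_b.symm⟩

theorem eq_a_of_le {x : L} (h : x ≤ C.a) (hx : C.proj x = D.u) : x = C.a := by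
  rcases C.eq_or x C.a (hx.trans C.proj_a.symm) with h1 | h1 | h1
  · exact h1
  · exact h1.1
  · exact absurd (h1.1 ▸ h) C.a_lt.not_ge

theorem eq_b_of_ge {x : L} (h : C.b ≤ x) (hx : C.proj x = D.u) : x = C.b := C.dual.eq_a_of_le h hx

theorem not_le_of_ge {x : L} (h : C.b ≤ x) : ¬ x ≤ C.a := fun h' => C.a_lt.not_ge (h.trans h')

open Classical in
/-- The second coordinate of the embedding of `L`. -/
noncomputable def coord (x : L) : F :=
  if x ≤ C.a then D.f₀ else if C.b ≤ x then D.f₁ else D.e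

theorem coord_of_le {x : L} (h : x ≤ C.a) : C.coord x = D.f₀ := if_pos h

theorem coord_of_ge {x : L} (h : C.b ≤ x) : C.coord x = D.f₁ := by
  rw [coord, if_neg (C.not_le_of_ge h), if_pos h]

theorem coord_of_not {x : L} (h : ¬ x ≤ C.a) (h' : ¬ C.b ≤ x) : C.coord x = D.e := by
  rw [coord, if_neg h, if_neg h']

theorem coord_le (x : L) : C.coord x ≤ D.f₁ := by
  unfold coord
  split_ifs
  exacts [D.f₀_le_f₁, le_rfl, D.le_f₁]

/-- The embedding of `L`. -/
noncomputable def emb (x : L) : Pt D where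
  x := C.proj x
  f := C.coord x
  low h := (C.coord_of_le (C.le_a_of_lt h)).le
  high h := (C.coord_of_ge (C.b_le_of_gt h)).ge
  thin h := by
    have hne : C.proj x ≠ D.u := fun h' => h (Or.inl ⟨h' ▸ D.t_le, h'.le⟩)
    by_cases h1 : x ≤ C.a
    · rw [C.coord_of_le h1, defaultCoord_of_lt (lt_of_le_of_ne (C.proj_le.2 (Or.inl h1)) hne)]
    · by_cases h2 : C.b ≤ x
      · rw [C.coord_of_ge h2,
          defaultCoord_of_gt (lt_of_le_of_ne (C.le_proj.2 (Or.inl h2)) hne.symm)]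
      · rw [C.coord_of_not h1 h2, defaultCoord_of_not (fun h => h1 (C.le_a_of_lt h))
          fun h => h2 (C.b_le_of_gt h)]

theorem coord_dual (x : L) :
    C.dual.coord (OrderDual.toDual x) = OrderDual.toDual (C.coord x) := by
  by_cases h : x ≤ C.a
  · rw [C.coord_of_le h]
    exact C.dual.coord_of_ge h
  · by_cases h' : C.b ≤ x
    · rw [C.coord_of_ge h']
      exact C.dual.coord_of_le h'
    · rw [C.coord_of_not h h']
      exact C.dual.coord_of_not h' h

theorem emb_dual (x : L) : C.dual.emb (OrderDual.toDual x) = Pt.dual (C.emb x) :=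
  Pt.ext rfl (C.coord_dual x)

theorem emb_a : C.emb C.a = D.mid D.f₀ := Pt.ext C.proj_a (C.coord_of_le le_rfl)

theorem emb_b : C.emb C.b = D.mid D.f₁ := Pt.ext C.proj_b (C.coord_of_ge le_rfl)

theorem emb_sup (x y : L) : C.emb (x ⊔ y) = C.emb x ⊔ C.emb y := by
  have hx : (C.emb (x ⊔ y)).x = (C.emb x ⊔ C.emb y).x := C.map_sup x y
  by_cases hthick : D.Thick (C.emb (x ⊔ y)).x
  swap
  · exact Pt.eq_of_not_thick hx hthick
  refine Pt.ext hx ?_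
  change C.coord (x ⊔ y) = _
  have hx' : C.proj (x ⊔ y) = C.proj x ⊔ C.proj y := hx
  by_cases hu : C.proj (x ⊔ y) ≤ D.u
  · have ht : D.t ≤ C.proj (x ⊔ y) := (thick_iff_of_le hu).1 hthick
    rcases C.proj_le.1 hu with h | h
    · have h1 : (C.emb x).f = D.f₀ := C.coord_of_le (le_sup_left.trans h)
      have h2 : (C.emb y).f = D.f₀ := C.coord_of_le (le_sup_right.trans h)
      rw [C.coord_of_le h]
      rw [hx'] at hu ht
      by_cases htx : D.t ≤ C.proj x
      · by_cases hty : D.t ≤ C.proj y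
        · rw [Pt.sup_f_of_le hu htx hty, h1, h2, sup_idem]
        · rw [Pt.sup_f_of_le_left hu htx hty, h1]
      · have hty := (D.prime_t _ _ (le_sup_left.trans hu) (le_sup_right.trans hu) ht).resolve_left
          htx
        rw [Pt.sup_f_of_le_right hu htx hty, h2]
    · rw [C.coord_of_ge h.ge]
      rw [hx'] at hu ht
      have key : x = C.b ∨ y = C.b := by
        rcases C.proj_le.1 (le_sup_left.trans hu) with h1 | h1
        · rcases C.proj_le.1 (le_sup_right.trans hu) with h2 | h2
          · exact absurd (h ▸ sup_le h1 h2) C.a_lt.not_ge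
          · exact Or.inr h2
        · exact Or.inl h1
      rcases key with rfl | rfl
      · have htb : D.t ≤ (C.emb C.b).x := D.t_le.trans C.proj_b.ge
        have h1 : (C.emb C.b).f = D.f₁ := C.coord_of_ge le_rfl
        by_cases hty : D.t ≤ C.proj y
        · rw [Pt.sup_f_of_le hu htb hty, h1]
          exact (sup_eq_left.2 (C.coord_le y)).symm
        · rw [Pt.sup_f_of_le_left hu htb hty, h1]
      · have htb : D.t ≤ (C.emb C.b).x := D.t_le.trans C.proj_b.ge
        have h1 : (C.emb C.b).f = D.f₁ := C.coord_of_ge le_rfl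
        by_cases htx : D.t ≤ C.proj x
        · rw [Pt.sup_f_of_le hu htx htb, h1]
          exact (sup_eq_right.2 (C.coord_le x)).symm
        · rw [Pt.sup_f_of_le_right hu htx htb, h1]
  · obtain ⟨h1, h2⟩ := hthick.resolve_left fun h => hu h.2
    have h3 : D.u < C.proj (x ⊔ y) := lt_of_le_of_ne h1 fun h => hu h.ge
    rw [C.coord_of_ge (C.b_le_of_gt h3)]
    change C.proj (x ⊔ y) ≤ D.s at h2
    rw [hx'] at h2 h3
    rw [Pt.sup_f_of_gt h3 h2, sup_assoc]
    exact (sup_eq_left.2 (sup_le (C.coord_le x) (C.coord_le y))).symm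

theorem emb_inf (x y : L) : C.emb (x ⊓ y) = C.emb x ⊓ C.emb y := by
  apply Pt.dual.injective
  rw [Pt.dual_inf, ← C.emb_dual, ← C.emb_dual, ← C.emb_dual]
  exact C.dual.emb_sup (OrderDual.toDual x) (OrderDual.toDual y)

/-- The restriction of a congruence to `L`. -/
noncomputable def restrict (c : LatCon (Pt D)) : LatCon L := c.comap C.emb C.emb_sup C.emb_inf

end Cover

end FibreData

namespace FibreData

variable {M F : Type*} [Lattice M] [Lattice F] {D : FibreData M F}

namespace Cover

variable {L : Type*} [Lattice L] (C : Cover D L)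

theorem emb_eq_of_not_thick {x : L} {X : Pt D} (h : C.proj x = X.x) (hX : ¬ D.Thick X.x) :
    C.emb x = X := (Pt.eq_of_not_thick (Y := C.emb x) h.symm hX).symm

theorem rel_iff_emb {c : LatCon (Pt D)} (hc : Collapses c) {X Y : Pt D} {x y : L}
    (hx : C.proj x = X.x) (hy : C.proj y = Y.x) : c.r X Y ↔ c.r (C.emb x) (C.emb y) := by
  have h1 : c.r (C.emb x) X := hc.rel hx
  have h2 : c.r (C.emb y) Y := hc.rel hy
  exact ⟨fun h => c.trans' h1 (c.trans' h (c.symm' h2)),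
    fun h => c.trans' (c.symm' h1) (c.trans' h h2)⟩

end Cover

/-- The element `(t, h)`. -/
def bottomPt (D : FibreData M F) (h : F) (hh : h ≤ D.f₀) : Pt D where
  x := D.t
  f := h
  low _ := hh
  high hu := absurd hu D.t_le.not_gt
  thin hn := absurd (Or.inl ⟨le_rfl, D.t_le⟩) hn

theorem t_le_of_rel (hF : IsSimpleLat F) (hmin : ∀ f : F, ∃ g, g < f) {c : LatCon (Pt D)}
    (hc : ¬ Collapses c) {X Y : Pt D} (hx : X.x ≤ D.u) (hy : Y.x ≤ D.u) (h : c.r X Y)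
    (ht : D.t ≤ Y.x) : D.t ≤ X.x := by
  by_contra htx
  apply hc
  obtain ⟨k, hk⟩ := hmin (Y.f ⊓ D.f₀)
  have hk0 : k ≤ D.f₀ := hk.le.trans inf_le_right
  let T := D.bottomPt (Y.f ⊓ D.f₀) inf_le_right
  let T' := D.bottomPt k hk0
  have hthin : ¬ D.Thick (X ⊓ T).x := fun h =>
    htx (((thick_iff_of_le (inf_le_left.trans hx)).1 h).trans inf_le_left)
  have hX : X ⊓ T = X ⊓ T' := Pt.eq_of_not_thick rfl hthin
  have hrel : c.r (Y ⊓ T) (Y ⊓ T') :=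
    c.trans' (c.symm' (c.inf_right h T)) (hX ▸ c.inf_right h T')
  refine collapses_of_rel hF (X := Y ⊓ T) (Y := Y ⊓ T') rfl ?_ hrel
  rw [Pt.inf_f_of_le hy D.t_le (le_inf ht le_rfl), Pt.inf_f_of_le hy D.t_le (le_inf ht le_rfl)]
  change Y.f ⊓ (Y.f ⊓ D.f₀) ≠ Y.f ⊓ k
  rw [← inf_assoc, inf_idem, inf_eq_right.2 (hk.le.trans inf_le_left)]
  exact hk.ne'

theorem f_eq_of_rel (hF : IsSimpleLat F) {c : LatCon (Pt D)} (hc : ¬ Collapses c) {X Y : Pt D}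
    (hx : X.x ≤ D.u) (hy : Y.x ≤ D.u) (h : c.r X Y) (htx : D.t ≤ X.x) (hty : D.t ≤ Y.x) :
    X.f = Y.f := by
  by_contra hne
  apply hc
  let T : Pt D :=
    { x := X.x ⊔ Y.x
      f := X.f ⊓ Y.f
      low := fun hu => inf_le_left.trans (X.low (le_sup_left.trans_lt hu))
      high := fun hu => absurd hu (sup_le hx hy).not_gt
      thin := fun hn => absurd (Or.inl ⟨htx.trans le_sup_left, sup_le hx hy⟩) hn }
  have hX : (X ⊔ T).f = X.f := by
    rw [Pt.sup_f_of_le (sup_le hx (sup_le hx hy)) htx (htx.trans le_sup_left)]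
    exact sup_eq_left.2 inf_le_left
  have hY : (Y ⊔ T).f = Y.f := by
    rw [Pt.sup_f_of_le (sup_le hy (sup_le hx hy)) hty (htx.trans le_sup_left)]
    exact sup_eq_left.2 inf_le_right
  refine collapses_of_rel hF (X := X ⊔ T) (Y := Y ⊔ T) ?_ ?_ (c.sup_right h T)
  · change X.x ⊔ (X.x ⊔ Y.x) = Y.x ⊔ (X.x ⊔ Y.x)
    rw [sup_eq_right.2 le_sup_left, sup_eq_right.2 le_sup_right]
  · rw [hX, hY]
    exact hne

namespace Cover

variable {L : Type*} [Lattice L] (C : Cover D L)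

theorem sup_bottom_inf_mid {X : Pt D} (hu : X.x ≤ D.u) (ht : D.t ≤ X.x) {x : L} (hx : x ≤ C.a)
    (hX : C.proj x = X.x) : (X ⊔ D.bottomPt D.f₀ le_rfl) ⊓ D.mid D.f₀ = C.emb x := by
  have hx1 : X.x ⊔ D.t = X.x := sup_eq_left.2 ht
  have hx2 : (X ⊔ D.bottomPt D.f₀ le_rfl).x ≤ D.u := hx1.le.trans hu
  have hx3 : (X ⊔ D.bottomPt D.f₀ le_rfl).x ⊓ D.u = X.x := by
    rw [inf_eq_left.2 hx2]
    exact hx1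
  refine Pt.ext (hx3.trans hX.symm) ?_
  rw [Pt.inf_f_of_le hx2 le_rfl (hx3 ▸ ht), Pt.sup_f_of_le hx2 ht le_rfl]
  change (X.f ⊔ D.f₀) ⊓ D.f₀ = C.coord x
  rw [C.coord_of_le hx, inf_eq_right]
  exact le_sup_right

theorem emb_inf_mid {X : Pt D} (hu : X.x ≤ D.u) (ht : D.t ≤ X.x) {x : L} (hx : x ≤ C.a)
    (hX : C.proj x = X.x) (hf : X.f ≤ D.f₀) : C.emb x ⊓ D.mid X.f = X := by
  have hx1 : (C.emb x).x ≤ D.u := hX.le.trans hu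
  have hx2 : (C.emb x).x ⊓ D.u = X.x := by
    rw [inf_eq_left.2 hx1]
    exact hX
  refine Pt.ext hx2 ?_
  rw [Pt.inf_f_of_le hx1 le_rfl (hx2 ▸ ht)]
  change C.coord x ⊓ X.f = X.f
  rw [C.coord_of_le hx, inf_eq_right]
  exact hf

theorem rel_of_le (hF : IsSimpleLat F) (hmin : ∀ f : F, ∃ g, g < f) {c d : LatCon (Pt D)}
    (hc : ¬ Collapses c) (hcd : ∀ x y, c.r (C.emb x) (C.emb y) → d.r (C.emb x) (C.emb y))
    {X Y : Pt D} (hx : X.x ≤ D.u) (hy : Y.x ≤ D.u) (h : c.r X Y) : d.r X Y := by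
  obtain ⟨x, hxa, hx'⟩ := C.exists_low hx
  obtain ⟨y, hya, hy'⟩ := C.exists_low hy
  by_cases htx : D.t ≤ X.x
  · have hty := t_le_of_rel hF hmin hc hy hx (c.symm' h) htx
    have hf := f_eq_of_rel hF hc hx hy h htx hty
    by_cases hf0 : X.f ≤ D.f₀
    · have h1 := c.inf_right (c.sup_right h (D.bottomPt D.f₀ le_rfl)) (D.mid D.f₀)
      rw [C.sup_bottom_inf_mid hx htx hxa hx', C.sup_bottom_inf_mid hy hty hya hy'] at h1
      have h2 := d.inf_right (hcd _ _ h1) (D.mid X.f)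
      rw [C.emb_inf_mid hx htx hxa hx' hf0, hf, C.emb_inf_mid hy hty hya hy' (hf ▸ hf0)] at h2
      exact h2
    · have h1 : X.x = D.u := eq_of_le_of_not_lt hx fun h => hf0 (X.low h)
      have h2 : Y.x = D.u := eq_of_le_of_not_lt hy fun h => hf0 (hf ▸ Y.low h)
      rw [Pt.ext (h1.trans h2.symm) hf]
      exact d.refl' _
  · have hty : ¬ D.t ≤ Y.x := fun hty => htx (t_le_of_rel hF hmin hc hx hy h hty)
    have h1 := C.emb_eq_of_not_thick hx' fun h => htx ((thick_iff_of_le hx).1 h)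
    have h2 := C.emb_eq_of_not_thick hy' fun h => hty ((thick_iff_of_le hy).1 h)
    rw [← h1, ← h2] at h ⊢
    exact hcd _ _ h

theorem collapses_of_lt (hF : IsSimpleLat F) {c : LatCon (Pt D)} {X Y : Pt D} (hx : X.x < D.u)
    (hy : ¬ Y.x ≤ D.u) (h : c.r X Y) (hf : D.f₀ ≠ D.f₁) : Collapses c := by
  have h1 := c.inf_right (c.sup_right h (D.mid D.f₀)) (D.mid D.f₁)
  have hY : D.u < (Y ⊔ D.mid D.f₀).x :=
    lt_of_le_of_ne le_sup_right fun h => hy (h ▸ le_sup_left)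
  rw [inf_eq_right.2 (mid_le_of_gt hY le_rfl), sup_eq_right.2 (le_mid_of_lt hx le_rfl),
    inf_eq_left.2 (mid_le_mid D.f₀_le_f₁)] at h1
  exact collapses_of_mid hF hf h1

theorem rel_of_ge (hF : IsSimpleLat F) (hmax : ∀ f : F, ∃ g, f < g) {c d : LatCon (Pt D)}
    (hc : ¬ Collapses c) (hcd : ∀ x y, c.r (C.emb x) (C.emb y) → d.r (C.emb x) (C.emb y))
    {X Y : Pt D} (hx : D.u ≤ X.x) (hy : D.u ≤ Y.x) (h : c.r X Y) : d.r X Y := by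
  refine C.dual.rel_of_le (isSimpleLat_dual hF) hmax (c := Pt.conDual c) (d := Pt.conDual d)
    (mt collapses_conDual.1 hc) (fun x y h => ?_) (X := Pt.dual X) (Y := Pt.dual Y) hx hy h
  have hx := C.emb_dual (OrderDual.ofDual x)
  have hy := C.emb_dual (OrderDual.ofDual y)
  rw [OrderDual.toDual_ofDual] at hx hy
  rw [hx, hy] at h ⊢
  exact hcd _ _ h

theorem restrict_le_restrict (hF : IsSimpleLat F) (hmin : ∀ f : F, ∃ g, g < f)
    (hmax : ∀ f : F, ∃ g, f < g) {c d : LatCon (Pt D)} (hcd : C.restrict c ≤ C.restrict d) :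
    c ≤ d := by
  have hcd' : ∀ x y, c.r (C.emb x) (C.emb y) → d.r (C.emb x) (C.emb y) := hcd
  suffices H : ∀ X Y, X ≤ Y → c.r X Y → d.r X Y from fun X Y h =>
    d.rel_of_inf_rel_sup (H _ _ (inf_le_left.trans le_sup_left) (c.inf_rel_sup h))
  intro X Y hXY h
  obtain ⟨x, hx⟩ := C.surj X.x
  obtain ⟨y, hy⟩ := C.surj Y.x
  by_cases hc : Collapses c
  · have hd : Collapses d := by
      refine collapses_of_mid hF C.f_lt.ne ?_
      rw [← C.emb_a, ← C.emb_b]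
      exact hcd' _ _ (by rw [C.emb_a, C.emb_b]; exact hc _ _)
    exact (C.rel_iff_emb hd hx hy).2 (hcd' _ _ ((C.rel_iff_emb hc hx hy).1 h))
  by_cases hYu : Y.x ≤ D.u
  · exact C.rel_of_le hF hmin hc hcd' (hXY.1.trans hYu) hYu h
  by_cases hXu : D.u ≤ X.x
  · exact C.rel_of_ge hF hmax hc hcd' hXu (hXu.trans hXY.1) h
  by_cases hX : X.x ≤ D.u
  · exact absurd (collapses_of_lt hF (lt_of_le_not_ge hX hXu) hYu h C.f_lt.ne) hc
  by_cases hY : D.u ≤ Y.x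
  · refine absurd (collapses_conDual.1 (collapses_of_lt (isSimpleLat_dual hF)
      (c := Pt.conDual c) (X := Pt.dual Y) (Y := Pt.dual X) (lt_of_le_not_ge hY hYu) hXu
      (c.symm' h) C.f_lt.ne')) hc
  · have h1 := C.emb_eq_of_not_thick hx fun h => h.elim (fun h => hX h.2) fun h => hXu h.1
    have h2 := C.emb_eq_of_not_thick hy fun h => h.elim (fun h => hYu h.2) fun h => hY h.1
    rw [← h1, ← h2] at h ⊢
    exact hcd' _ _ h

end Cover

end FibreData

namespace FibreData

variable {M F : Type*} [Lattice M] [Lattice F] {D : FibreData M F}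

theorem supCoord_congr_of_not_le {X Y Z : Pt D} (hx : ¬ X.x ⊔ Z.x ≤ D.u)
    (hy : ¬ Y.x ⊔ Z.x ≤ D.u) (hu : D.u < X.x ⊔ Z.x ↔ D.u < Y.x ⊔ Z.x)
    (hs : D.u < X.x ⊔ Z.x → (X.x ⊔ Z.x ≤ D.s ↔ Y.x ⊔ Z.x ≤ D.s)) (hf : X.f = Y.f) :
    (X ⊔ Z).f = (Y ⊔ Z).f := by
  by_cases h : D.u < X.x ⊔ Z.x
  · by_cases h' : X.x ⊔ Z.x ≤ D.s
    · rw [Pt.sup_f_of_gt h h', Pt.sup_f_of_gt (hu.1 h) ((hs h).1 h'), hf]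
    · rw [(X ⊔ Z).thin fun ht => h' ((thick_iff_of_ge (le_of_lt h)).1 ht),
        (Y ⊔ Z).thin fun ht => h' ((hs h).2 ((thick_iff_of_ge (le_of_lt (hu.1 h))).1 ht))]
      exact (defaultCoord_of_gt h).trans (defaultCoord_of_gt (hu.1 h)).symm
  · have hx' : ¬ D.Thick (X ⊔ Z).x := fun ht =>
      ht.elim (fun ht => hx ht.2) fun ht => h (lt_of_le_of_ne ht.1 fun h => hx h.ge)
    have hy' : ¬ D.Thick (Y ⊔ Z).x := fun ht =>
      ht.elim (fun ht => hy ht.2) fun ht => h (hu.2 (lt_of_le_of_ne ht.1 fun h => hy h.ge))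
    rw [(X ⊔ Z).thin hx', (Y ⊔ Z).thin hy']
    exact (defaultCoord_of_not (fun h => hx h.le) h).trans
      (defaultCoord_of_not (fun h => hy h.le) (fun h' => h (hu.2 h'))).symm

theorem supCoord_congr_of_le {X Y Z : Pt D} (hx : X.x ⊔ Z.x ≤ D.u) (hy : Y.x ⊔ Z.x ≤ D.u)
    (ht : D.t ≤ X.x ↔ D.t ≤ Y.x) (hf : X.f = Y.f) : (X ⊔ Z).f = (Y ⊔ Z).f := by
  by_cases hX : D.t ≤ X.x
  · by_cases hZ : D.t ≤ Z.x
    · rw [Pt.sup_f_of_le hx hX hZ, Pt.sup_f_of_le hy (ht.1 hX) hZ, hf]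
    · rw [Pt.sup_f_of_le_left hx hX hZ, Pt.sup_f_of_le_left hy (ht.1 hX) hZ, hf]
  · by_cases hZ : D.t ≤ Z.x
    · rw [Pt.sup_f_of_le_right hx hX hZ, Pt.sup_f_of_le_right hy (fun h => hX (ht.2 h)) hZ]
    · have key : ∀ V : Pt D, V.x ⊔ Z.x ≤ D.u → ¬ D.t ≤ V.x → (V ⊔ Z).f = D.f₀ := by
        intro V hV hVt
        have h1 : ¬ D.t ≤ V.x ⊔ Z.x := fun h =>
          (D.prime_t _ _ (le_sup_left.trans hV) (le_sup_right.trans hV) h).elim hVt hZ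
        rw [(V ⊔ Z).thin fun h => h1 ((thick_iff_of_le hV).1 h)]
        exact defaultCoord_of_lt (lt_of_le_of_ne hV fun h => h1 (D.t_le.trans (ge_of_eq h)))
      rw [key X hx hX, key Y hy fun h => hX (ht.2 h)]

theorem supCoord_congr_of_eq {X Y Z : Pt D} (hx : X.x = D.u) (hy : D.u < Y.x) (hs : Y.x ≤ D.s)
    (hz : Z.x ≤ D.u) (hf : X.f = Y.f) : (X ⊔ Z).f = (Y ⊔ Z).f := by
  have h1 : Y.x ⊔ Z.x = Y.x := sup_eq_left.2 (hz.trans hy.le)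
  rw [Pt.sup_f_of_gt (X := Y) (hy.trans_eq h1.symm) (h1.trans_le hs), sup_eq_right.2 (Y.high hy),
    ← hf]
  have h2 : X.x ⊔ Z.x ≤ D.u := sup_le hx.le hz
  by_cases ht : D.t ≤ Z.x
  · rw [Pt.sup_f_of_le h2 (hx ▸ D.t_le) ht]
  · rw [Pt.sup_f_of_le_left h2 (hx ▸ D.t_le) ht]
    have hz' : Z.x < D.u := lt_of_le_of_ne hz fun h => ht (h ▸ D.t_le)
    exact (sup_eq_left.2 ((Z.low hz').trans (D.f₀_le_f₁.trans (hf ▸ Y.high hy)))).symm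

namespace Cover

variable {L : Type*} [Lattice L] (C : Cover D L)

theorem proj_le_of_le {x : L} (h : x ≤ C.a) : C.proj x ≤ D.u := C.proj_le.2 (Or.inl h)

theorem le_proj_of_le {x : L} (h : C.b ≤ x) : D.u ≤ C.proj x := C.le_proj.2 (Or.inl h)

theorem le_a_of_rel {d : LatCon L} (hd : ¬ d.r C.a C.b) {x y : L} (h : d.r x y) (hx : x ≤ C.a) :
    y ≤ C.a := by
  by_contra hy
  apply hd
  have h1 : C.b ≤ C.a ⊔ y := by
    refine (C.le_proj.1 ?_).resolve_right fun h => hy (sup_eq_left.1 h)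
    rw [C.map_sup, C.proj_a]
    exact le_sup_left
  have h2 := d.inf' (d.sup' (d.refl' C.a) h) (d.refl' C.b)
  rw [sup_eq_left.2 hx, inf_eq_left.2 C.a_lt.le, inf_eq_right.2 h1] at h2
  exact h2

theorem b_le_of_rel {d : LatCon L} (hd : ¬ d.r C.a C.b) {x y : L} (h : d.r x y) (hx : C.b ≤ x) :
    C.b ≤ y :=
  C.dual.le_a_of_rel (d := LatCon.dual d) (fun h => hd (d.symm' h)) h hx

theorem rel_of_proj_eq {d : LatCon L} (hd : d.r C.a C.b) {x y : L} (h : C.proj x = C.proj y) :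
    d.r x y := by
  rcases C.eq_or x y h with rfl | ⟨rfl, rfl⟩ | ⟨rfl, rfl⟩
  exacts [d.refl' _, hd, d.symm' hd]

/-- The extension of a congruence of `L` not collapsing `a` and `b`. -/
def Ext (d : LatCon L) (X Y : Pt D) : Prop :=
  X.f = Y.f ∧ ∃ x y, C.proj x = X.x ∧ C.proj y = Y.x ∧ d.r x y

theorem Ext.symm {C : Cover D L} {d : LatCon L} {X Y : Pt D} (h : C.Ext d X Y) : C.Ext d Y X := by
  obtain ⟨hf, x, y, hx, hy, h⟩ := h
  exact ⟨hf.symm, y, x, hy, hx, d.symm' h⟩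

theorem Ext.refl {C : Cover D L} {d : LatCon L} (X : Pt D) : C.Ext d X X := by
  obtain ⟨x, hx⟩ := C.surj X.x
  exact ⟨rfl, x, x, hx, hx, d.refl' x⟩

theorem ext_trans_aux {d : LatCon L} (hd : ¬ d.r C.a C.b) {X Y Z : Pt D} {x z : L}
    (hx : C.proj x = X.x) (hy : Y.x = D.u) (hz : C.proj z = Z.x) (hxa : d.r x C.a)
    (hzb : d.r C.b z) (hXY : X.f = Y.f) (hYZ : Y.f = Z.f) : C.Ext d X Z := by
  have hxle := C.le_a_of_rel hd (d.symm' hxa) le_rfl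
  have hzge := C.b_le_of_rel hd hzb le_rfl
  by_cases hxu : X.x = D.u
  · have : X = Y := Pt.ext (hxu.trans hy.symm) hXY
    subst this
    exact ⟨hYZ, C.b, z, C.proj_b.trans hy.symm, hz, hzb⟩
  by_cases hzu : Z.x = D.u
  · have : Z = Y := Pt.ext (hzu.trans hy.symm) hYZ.symm
    subst this
    exact ⟨hXY, x, C.a, hx, C.proj_a.trans hy.symm, hxa⟩
  · have h1 := X.low (lt_of_le_of_ne (hx ▸ C.proj_le_of_le hxle) hxu)
    have h2 := Z.high (lt_of_le_of_ne (hz ▸ C.le_proj_of_le hzge) (Ne.symm hzu))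
    exact absurd (h2.trans ((hXY.trans hYZ).ge.trans h1)) C.f_lt.not_ge

theorem ext_trans {d : LatCon L} (hd : ¬ d.r C.a C.b) {X Y Z : Pt D} (h : C.Ext d X Y)
    (h' : C.Ext d Y Z) : C.Ext d X Z := by
  obtain ⟨hf, x, y, hx, hy, hxy⟩ := h
  obtain ⟨hf', y', z, hy', hz, hyz⟩ := h'
  rcases C.eq_or y y' (hy.trans hy'.symm) with rfl | ⟨rfl, rfl⟩ | ⟨rfl, rfl⟩
  · exact ⟨hf.trans hf', x, z, hx, hz, d.trans' hxy hyz⟩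
  · exact C.ext_trans_aux hd hx (hy.symm.trans C.proj_a) hz hxy hyz hf hf'
  · exact (C.ext_trans_aux hd hz (hy.symm.trans C.proj_b) hx (d.symm' hyz) (d.symm' hxy)
      hf'.symm hf.symm).symm

theorem ext_sup_aux {d : LatCon L} (hd : ¬ d.r C.a C.b) {X Y Z : Pt D} {x y : L}
    (hx : C.proj x = X.x) (hy : C.proj y = Y.x) (hxb : C.b ≤ x) (hyb : C.b ≤ y) (h : d.r x y)
    (hf : X.f = Y.f) (hX : X.x ⊔ Z.x ≤ D.u) : (X ⊔ Z).f = (Y ⊔ Z).f := by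
  have hXu : X.x = D.u := le_antisymm (le_sup_left.trans hX) (hx ▸ C.le_proj_of_le hxb)
  by_cases hYu : Y.x = D.u
  · rw [show X = Y from Pt.ext (hXu.trans hYu.symm) hf]
  · have hxb' : x = C.b := C.eq_b_of_ge hxb (hx.trans hXu)
    have hs := C.stable_s d hd x y hxb hyb h (hx.trans hXu ▸ D.le_s)
    exact supCoord_congr_of_eq hXu
      (lt_of_le_of_ne (hy ▸ C.le_proj_of_le hyb) (Ne.symm hYu)) (hy ▸ hs)
      (le_sup_right.trans hX) hf

theorem ext_sup {d : LatCon L} (hd : ¬ d.r C.a C.b) {X Y : Pt D} (Z : Pt D) (h : C.Ext d X Y) :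
    C.Ext d (X ⊔ Z) (Y ⊔ Z) := by
  obtain ⟨hf, x, y, hx, hy, hxy⟩ := h
  obtain ⟨z, hz⟩ := C.surj Z.x
  have hxz : C.proj (x ⊔ z) = X.x ⊔ Z.x := by rw [C.map_sup, hx, hz]
  have hyz : C.proj (y ⊔ z) = Y.x ⊔ Z.x := by rw [C.map_sup, hy, hz]
  have hrel := d.sup_right hxy z
  refine ⟨?_, x ⊔ z, y ⊔ z, hxz, hyz, hrel⟩
  have hge : C.b ≤ x → C.b ≤ y := C.b_le_of_rel hd hxy
  have hge' : C.b ≤ y → C.b ≤ x := C.b_le_of_rel hd (d.symm' hxy)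
  have hle : x ≤ C.a → y ≤ C.a := C.le_a_of_rel hd hxy
  have hle' : y ≤ C.a → x ≤ C.a := C.le_a_of_rel hd (d.symm' hxy)
  by_cases hX : X.x ⊔ Z.x ≤ D.u
  · rcases C.proj_le.1 (hx.le.trans (le_sup_left.trans hX)) with hxa | rfl
    · have hY : Y.x ⊔ Z.x ≤ D.u :=
        sup_le (hy ▸ C.proj_le_of_le (hle hxa)) (le_sup_right.trans hX)
      refine supCoord_congr_of_le hX hY ⟨fun h => ?_, fun h => ?_⟩ hf
      · rw [← hx] at h
        exact hy ▸ C.stable_t d hd x y hxa (hle hxa) hxy h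
      · rw [← hy] at h
        exact hx ▸ C.stable_t d hd y x (hle hxa) hxa (d.symm' hxy) h
    · exact C.ext_sup_aux hd hx hy le_rfl (hge le_rfl) hxy hf hX
  by_cases hY : Y.x ⊔ Z.x ≤ D.u
  · rcases C.proj_le.1 (hy.le.trans (le_sup_left.trans hY)) with hya | rfl
    · exact absurd (sup_le (hx ▸ C.proj_le_of_le (hle' hya)) (le_sup_right.trans hY)) hX
    · exact (C.ext_sup_aux hd hy hx le_rfl (hge' le_rfl) (d.symm' hxy) hf.symm hY).symm
  have hgex : D.u < X.x ⊔ Z.x → C.b ≤ x ⊔ z := fun h => C.b_le_of_gt (hxz ▸ h)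
  have hgey : D.u < Y.x ⊔ Z.x → C.b ≤ y ⊔ z := fun h => C.b_le_of_gt (hyz ▸ h)
  refine supCoord_congr_of_not_le hX hY ⟨fun h => ?_, fun h => ?_⟩ (fun h => ⟨fun hs => ?_,
    fun hs => ?_⟩) hf
  · refine lt_of_le_of_ne ?_ fun h => hY h.ge
    exact hyz ▸ C.le_proj_of_le (C.b_le_of_rel hd hrel (hgex h))
  · refine lt_of_le_of_ne ?_ fun h => hX h.ge
    exact hxz ▸ C.le_proj_of_le (C.b_le_of_rel hd (d.symm' hrel) (hgey h))
  · have h1 := C.b_le_of_rel hd hrel (hgex h)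
    exact hyz ▸ C.stable_s d hd _ _ (hgex h) h1 hrel (hxz.le.trans hs)
  · have h1 := C.b_le_of_rel hd hrel (hgex h)
    exact hxz ▸ C.stable_s d hd _ _ h1 (hgex h) (d.symm' hrel) (hyz.le.trans hs)

theorem ext_inf {d : LatCon L} (hd : ¬ d.r C.a C.b) {X Y : Pt D} (Z : Pt D) (h : C.Ext d X Y) :
    C.Ext d (X ⊓ Z) (Y ⊓ Z) :=
  C.dual.ext_sup (d := LatCon.dual d) (fun h => hd (d.symm' h)) (X := Pt.dual X) (Y := Pt.dual Y)
    (Pt.dual Z) h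

/-- The extension as a congruence. -/
noncomputable def extCon (d : LatCon L) (hd : ¬ d.r C.a C.b) : LatCon (Pt D) :=
  LatCon.ofOneSided (C.Ext d) Ext.refl Ext.symm (C.ext_trans hd) (C.ext_sup hd) (C.ext_inf hd)

/-- The extension of a congruence of `L` collapsing `a` and `b`. -/
noncomputable def collapsedCon (d : LatCon L) (hd : d.r C.a C.b) : LatCon (Pt D) where
  r X Y := ∃ x y, C.proj x = X.x ∧ C.proj y = Y.x ∧ d.r x y
  refl' X := by
    obtain ⟨x, hx⟩ := C.surj X.x
    exact ⟨x, x, hx, hx, d.refl' x⟩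
  symm' := by
    rintro X Y ⟨x, y, hx, hy, h⟩
    exact ⟨y, x, hy, hx, d.symm' h⟩
  trans' := by
    rintro X Y Z ⟨x, y, hx, hy, h⟩ ⟨y', z, hy', hz, h'⟩
    exact ⟨x, z, hx, hz, d.trans' h (d.trans' (C.rel_of_proj_eq hd (hy.trans hy'.symm)) h')⟩
  sup' := by
    rintro X Y X' Y' ⟨x, y, hx, hy, h⟩ ⟨x', y', hx', hy', h'⟩
    exact ⟨x ⊔ x', y ⊔ y', by rw [C.map_sup, hx, hx', Pt.sup_x],
      by rw [C.map_sup, hy, hy', Pt.sup_x], d.sup' h h'⟩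
  inf' := by
    rintro X Y X' Y' ⟨x, y, hx, hy, h⟩ ⟨x', y', hx', hy', h'⟩
    exact ⟨x ⊓ x', y ⊓ y', by rw [C.map_inf, hx, hx', Pt.inf_x],
      by rw [C.map_inf, hy, hy', Pt.inf_x], d.inf' h h'⟩

theorem coord_eq_of_rel {d : LatCon L} (hd : ¬ d.r C.a C.b) {x y : L} (h : d.r x y) :
    C.coord x = C.coord y := by
  by_cases hx : x ≤ C.a
  · rw [C.coord_of_le hx, C.coord_of_le (C.le_a_of_rel hd h hx)]
  · by_cases hx' : C.b ≤ x
    · rw [C.coord_of_ge hx', C.coord_of_ge (C.b_le_of_rel hd h hx')]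
    · rw [C.coord_of_not hx hx', C.coord_of_not (fun h' => hx (C.le_a_of_rel hd (d.symm' h) h'))
        fun h' => hx' (C.b_le_of_rel hd (d.symm' h) h')]

theorem eq_of_proj_eq {x y : L} (h : C.proj x = C.proj y) (hf : C.coord x = C.coord y) :
    x = y := by
  rcases C.eq_or x y h with h | ⟨rfl, rfl⟩ | ⟨rfl, rfl⟩
  · exact h
  · rw [C.coord_of_le le_rfl, C.coord_of_ge le_rfl] at hf
    exact absurd hf C.f_lt.ne
  · rw [C.coord_of_le le_rfl, C.coord_of_ge le_rfl] at hf
    exact absurd hf C.f_lt.ne'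

theorem exists_restrict_eq (d : LatCon L) : ∃ c, C.restrict c = d := by
  by_cases hd : d.r C.a C.b
  · refine ⟨C.collapsedCon d hd, ?_⟩
    ext x y
    constructor
    · rintro ⟨x', y', hx, hy, h⟩
      exact d.trans' (C.rel_of_proj_eq hd hx.symm) (d.trans' h (C.rel_of_proj_eq hd hy))
    · exact fun h => ⟨x, y, rfl, rfl, h⟩
  · refine ⟨C.extCon d hd, ?_⟩
    ext x y
    constructor
    · rintro ⟨hf, x', y', hx, hy, h⟩
      have hf' := C.coord_eq_of_rel hd h
      change C.coord x = C.coord y at hf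
      change C.proj x' = C.proj x at hx
      change C.proj y' = C.proj y at hy
      by_cases hxx : x' = x
      · subst hxx
        exact C.eq_of_proj_eq hy (hf'.symm.trans hf) ▸ h
      by_cases hyy : y' = y
      · subst hyy
        exact C.eq_of_proj_eq hx (hf'.trans hf.symm) ▸ h
      rcases C.eq_or _ _ hx with h1 | ⟨rfl, rfl⟩ | ⟨rfl, rfl⟩
      · exact absurd h1 hxx
      · rcases C.eq_or _ _ hy with h2 | ⟨rfl, rfl⟩ | ⟨rfl, rfl⟩
        · exact absurd h2 hyy
        · exact d.refl' _
        · exact absurd h hd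
      · rcases C.eq_or _ _ hy with h2 | ⟨rfl, rfl⟩ | ⟨rfl, rfl⟩
        · exact absurd h2 hyy
        · exact absurd (d.symm' h) hd
        · exact d.refl' _
    · exact fun h => ⟨C.coord_eq_of_rel hd h, x, y, rfl, rfl, h⟩

end Cover

/-- Restriction to `L` is an isomorphism of congruence lattices. -/
theorem Cover.nonempty_orderIso {L : Type*} [Lattice L] (C : Cover D L) (hF : IsSimpleLat F)
    (hmin : ∀ f : F, ∃ g, g < f) (hmax : ∀ f : F, ∃ g, f < g) :
    Nonempty (LatCon (Pt D) ≃o LatCon L) :=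
  ⟨RelIso.ofSurjective (OrderEmbedding.ofMapLEIff C.restrict fun _ _ =>
    ⟨C.restrict_le_restrict hF hmin hmax, fun h _ _ => h _ _⟩) C.exists_restrict_eq⟩

end FibreData

/-- A simple semidistributive infinite lattice has no least element. -/
theorem exists_lt_of_isFN {F : Type*} [Lattice F] (hF : IsFN F) (f : F) : ∃ g, g < f := by
  obtain ⟨hinf, hsimple, hsd⟩ := hF
  by_contra hf
  have bot : ∀ g, f ≤ g := fun g => by
    by_contra hg
    exact hf ⟨f ⊓ g, lt_of_le_of_ne inf_le_left fun h => hg (inf_eq_left.1 h)⟩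
  obtain ⟨v, hv⟩ := exists_ne f
  let S : Set (Set F) :=
    {P | (∀ x y, x ≤ y → x ∈ P → y ∈ P) ∧ (∀ x y, x ∈ P → y ∈ P → x ⊓ y ∈ P) ∧ f ∉ P}
  obtain ⟨P, hvP, hP⟩ : ∃ P, Set.Ici v ⊆ P ∧ Maximal (· ∈ S) P := by
    refine zorn_subset_nonempty S (fun c hc hchain _ => ⟨⋃₀ c, ⟨?_, ?_, ?_⟩,
      fun s hs => Set.subset_sUnion_of_mem hs⟩) (Set.Ici v)
      ⟨fun x y hxy hx => le_trans hx hxy, fun x y hx hy => le_inf hx hy,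
        fun h => hv (le_antisymm h (bot v))⟩
    · rintro x y hxy ⟨s, hs, hx⟩
      exact ⟨s, hs, (hc hs).1 x y hxy hx⟩
    · rintro x y ⟨s, hs, hx⟩ ⟨s', hs', hy⟩
      rcases hchain.total hs hs' with h | h
      · exact ⟨s', hs', (hc hs').2.1 x y (h hx) hy⟩
      · exact ⟨s, hs, (hc hs).2.1 x y hx (h hy)⟩
    · rintro ⟨s, hs, h⟩
      exact (hc hs).2.2 h
  obtain ⟨⟨hup, hmeet, hfP⟩, hmax⟩ := hP
  have hv' : v ∈ P := hvP le_rfl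
  have disj : ∀ x, x ∉ P → ∃ p ∈ P, p ⊓ x = f := by
    intro x hx
    by_contra hdisj
    have hmem : {z | ∃ p ∈ P, p ⊓ x ≤ z} ∈ S := by
      refine ⟨?_, ?_, ?_⟩
      · rintro y z hyz ⟨p, hp, h⟩
        exact ⟨p, hp, h.trans hyz⟩
      · rintro y z ⟨p, hp, h⟩ ⟨q, hq, h'⟩
        exact ⟨p ⊓ q, hmeet p q hp hq, le_inf ((inf_le_inf_right x inf_le_left).trans h)
          ((inf_le_inf_right x inf_le_right).trans h')⟩
      · rintro ⟨p, hp, h⟩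
        exact hdisj ⟨p, hp, le_antisymm h (bot _)⟩
    exact hx (hmax hmem (fun p hp => ⟨p, hp, inf_le_left⟩) ⟨v, hv', inf_le_right⟩)
  have prime : ∀ x y, x ⊔ y ∈ P → x ∈ P ∨ y ∈ P := by
    intro x y hxy
    by_contra hn
    obtain ⟨hx, hy⟩ := not_or.1 hn
    obtain ⟨p, hp, hpx⟩ := disj x hx
    obtain ⟨q, hq, hqy⟩ := disj y hy
    have h1 : f = p ⊓ q ⊓ x :=
      le_antisymm (bot _) ((inf_le_inf_right x inf_le_left).trans hpx.le)
    have h2 : f = p ⊓ q ⊓ y :=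
      le_antisymm (bot _) ((inf_le_inf_right y inf_le_right).trans hqy.le)
    exact hfP (hsd.2 f (p ⊓ q) x y h1 h2 ▸ hmeet _ _ (hmeet p q hp hq) hxy)
  have hsup : ∀ x y, x ⊔ y ∈ P ↔ x ∈ P ∨ y ∈ P := fun x y =>
    ⟨prime x y, fun h => h.elim (hup _ _ le_sup_left) (hup _ _ le_sup_right)⟩
  have hinf' : ∀ x y, x ⊓ y ∈ P ↔ x ∈ P ∧ y ∈ P := fun x y =>
    ⟨fun h => ⟨hup _ _ inf_le_left h, hup _ _ inf_le_right h⟩, fun h => hmeet _ _ h.1 h.2⟩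
  let c : LatCon F :=
    { r := fun x y => x ∈ P ↔ y ∈ P
      refl' := fun _ => Iff.rfl
      symm' := Iff.symm
      trans' := Iff.trans
      sup' := fun h h' => by rw [hsup, hsup, h, h']
      inf' := fun h h' => by rw [hinf', hinf', h, h'] }
  rcases hsimple.2 c with hc | hc
  · have hinj : Function.Injective (fun x => x ∈ P) := fun x y hxy => by
      have : c.r x y := Iff.of_eq hxy
      rw [hc] at this
      exact this
    exact hinf.not_finite (Finite.of_injective _ hinj)
  · have : c.r v f := by rw [hc]; trivial
    exact hfP (this.1 hv')

theorem exists_gt_of_isFN {F : Type*} [Lattice F] (hF : IsFN F) (f : F) : ∃ g, f < g :=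
  have := hF.1
  exists_lt_of_isFN (F := Fᵒᵈ) ⟨inferInstanceAs (Infinite F),
    FibreData.isSimpleLat_dual hF.2.1, hF.2.2.2, hF.2.2.1⟩ f

/-- For every congruence `ψ` there is an element below `a` that is prime below `a` and whose
principal filter is `ψ`-saturated below `a`. -/
theorem exists_prime_saturated {L : Type*} [Lattice L] [Finite L] (hL : MeetSD L) (a : L)
    (ψ : LatCon L) :
    ∃ t ≤ a, (∀ x y, x ≤ a → y ≤ a → t ≤ x ⊔ y → t ≤ x ∨ t ≤ y) ∧
      ∀ x y, x ≤ a → y ≤ a → ψ.r x y → t ≤ x → t ≤ y := by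
  have : Nonempty L := ⟨a⟩
  obtain ⟨o, ho⟩ : ∃ o : L, ∀ x, o ≤ x := by
    obtain ⟨o, ho⟩ := Set.toFinite (Set.univ : Set L) |>.exists_minimal Set.univ_nonempty
    exact ⟨o, fun x => (ho.2 trivial inf_le_left).trans (inf_le_right (a := o) (b := x))⟩
  by_cases hoa : ψ.r o a
  · exact ⟨o, ho a, fun x _ _ _ _ => Or.inl (ho x), fun _ y _ _ _ _ => ho y⟩
  obtain ⟨t, ht⟩ := Set.toFinite {z | z ≤ a ∧ ¬ ψ.r o z} |>.exists_minimal ⟨a, le_rfl, hoa⟩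
  obtain ⟨⟨hta, hot⟩, hmin⟩ := ht
  have hlt : ∀ z, z < t → ψ.r o z := by
    intro z hz
    by_contra h
    exact hz.not_ge (hmin ⟨hz.le.trans hta, h⟩ hz.le)
  have hne : ∀ z ≤ t, ψ.r o z → z < t := fun z hz h =>
    lt_of_le_of_ne hz fun h' => hot (h' ▸ h)
  refine ⟨t, hta, fun x y _ _ hxy => ?_, fun x y _ _ h htx => ?_⟩
  · by_contra hn
    obtain ⟨hx, hy⟩ := not_or.1 hn
    obtain ⟨v, hvt, hvmax⟩ := Set.toFinite {z | z < t} |>.exists_maximal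
      ⟨o, hne o (ho t) (ψ.refl' o)⟩
    have hv : ∀ z, z < t → z ≤ v := by
      intro z hz
      have h1 := ψ.sup' (hlt z hz) (hlt v hvt)
      rw [sup_idem] at h1
      exact le_sup_left.trans (hvmax (hne _ (sup_le hz.le (le_of_lt hvt)) h1) le_sup_right)
    have key : ∀ x, ¬ t ≤ x → v = t ⊓ (x ⊔ v) := by
      intro x hx
      refine le_antisymm (le_inf (le_of_lt hvt) le_sup_right) (hv _ (hne _ inf_le_left ?_))
      have h1 : ψ.r o (t ⊓ x) :=
        hlt _ (lt_of_le_of_ne inf_le_left fun h => hx (inf_eq_left.1 h))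
      have h2 := ψ.inf' (ψ.refl' t) (ψ.sup' (ψ.refl' x) (hlt v hvt))
      rw [sup_eq_left.2 (ho x)] at h2
      exact ψ.trans' h1 h2
    have h := hL v t _ _ (key x hx) (key y hy)
    have h1 : t ≤ x ⊔ v ⊔ (y ⊔ v) := hxy.trans (sup_le_sup le_sup_left le_sup_left)
    rw [inf_eq_left.2 h1] at h
    exact (ne_of_lt hvt) h
  · by_contra hty
    have h1 := ψ.inf_right h t
    rw [inf_eq_right.2 htx] at h1
    have h2 := hlt (y ⊓ t) (lt_of_le_of_ne inf_le_right fun h => hty (inf_eq_right.1 h))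
    exact hot (ψ.trans' h2 (ψ.symm' h1))

namespace Isolated

variable {L : Type*} [Lattice L] {a b : L}

theorem le_of_lt (h : Isolated a b) {z : L} (hz : z < b) : z ≤ a := by
  rcases h.1.eq_or_eq (le_sup_right : a ≤ z ⊔ a) (sup_le hz.le h.1.le) with h1 | h1
  · exact sup_eq_right.1 h1
  · rcases h.2.2.2.1.2 h1 with h2 | h2
    exacts [absurd h2 hz.ne, absurd h2 h.1.lt.ne]

theorem ge_of_gt (h : Isolated a b) {z : L} (hz : a < z) : b ≤ z := by
  rcases h.1.eq_or_eq (le_inf hz.le h.1.le : a ≤ z ⊓ b) inf_le_right with h1 | h1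
  · rcases h.2.2.1.2 h1 with h2 | h2
    exacts [absurd h2 hz.ne', absurd h2 h.1.lt.ne']
  · exact inf_eq_right.1 h1

/-- The sublattice of all elements different from `b`. -/
abbrev lattice (h : Isolated a b) : Lattice {x : L // x ≠ b} :=
  Subtype.lattice (fun _ _ hx hy hxy => (h.2.2.2.1.2 hxy).elim hx hy)
    (fun _ _ hx hy hxy => (h.2.2.2.2.2 hxy).elim hx hy)

open Classical in
/-- The map collapsing `b` to `a`. -/
noncomputable def proj (h : Isolated a b) (x : L) : {x : L // x ≠ b} :=
  if hx : x = b then ⟨a, h.1.lt.ne⟩ else ⟨x, hx⟩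

theorem proj_right (h : Isolated a b) : h.proj b = ⟨a, h.1.lt.ne⟩ := dif_pos rfl

theorem proj_of_ne (h : Isolated a b) {x : L} (hx : x ≠ b) : h.proj x = ⟨x, hx⟩ := dif_neg hx

theorem proj_le (h : Isolated a b) (x : L) : (h.proj x : L) ≤ x := by
  by_cases hx : x = b
  · rw [hx, h.proj_right]
    exact h.1.le
  · rw [h.proj_of_ne hx]

theorem le_proj (h : Isolated a b) {x z : L} (hx : x ≠ b) (hxz : x ≤ z) : x ≤ h.proj z := by
  by_cases hz : z = b
  · rw [hz, h.proj_right]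
    exact h.le_of_lt (lt_of_le_of_ne (hz ▸ hxz) hx)
  · rw [h.proj_of_ne hz]
    exact hxz

theorem proj_sup (h : Isolated a b) (x y : L) : (h.proj (x ⊔ y) : L) = (h.proj x : L) ⊔ h.proj y := by
  have key : ∀ y, y ≠ b → (h.proj (b ⊔ y) : L) = a ⊔ y := by
    intro y hy
    by_cases hyb : y ≤ b
    · rw [sup_eq_left.2 hyb, h.proj_right]
      exact (sup_eq_left.2 (h.le_of_lt (lt_of_le_of_ne hyb hy))).symm
    · have hne : b ⊔ y ≠ b := fun h => hyb (sup_eq_left.1 h)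
      have hb : b ≤ a ⊔ y := h.ge_of_gt (lt_of_le_of_ne le_sup_left fun h' =>
        hyb ((sup_eq_left.1 h'.symm).trans h.1.le))
      rw [h.proj_of_ne hne]
      exact le_antisymm (sup_le hb le_sup_right) (sup_le_sup_right h.1.le y)
  by_cases hx : x = b
  · subst hx
    by_cases hy : y = x
    · rw [hy, sup_idem, sup_idem]
    · rw [h.proj_right, h.proj_of_ne hy]
      exact key y hy
  · by_cases hy : y = b
    · subst hy
      rw [h.proj_right, h.proj_of_ne hx, sup_comm, key x hx, sup_comm]
    · have hxy : x ⊔ y ≠ b := fun h' => (h.2.2.2.1.2 h').elim hx hy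
      rw [h.proj_of_ne hxy, h.proj_of_ne hx, h.proj_of_ne hy]

theorem proj_inf (h : Isolated a b) (x y : L) : (h.proj (x ⊓ y) : L) = (h.proj x : L) ⊓ h.proj y := by
  apply le_antisymm
  · have hne := (h.proj (x ⊓ y)).2
    have hle := h.proj_le (x ⊓ y)
    exact le_inf (h.le_proj hne (hle.trans inf_le_left)) (h.le_proj hne (hle.trans inf_le_right))
  · exact h.le_proj (fun h' => (h.2.2.2.2.2 h').elim (h.proj x).2 (h.proj y).2)
      (inf_le_inf (h.proj_le x) (h.proj_le y))

theorem eq_or_of_proj_eq (h : Isolated a b) {x y : L} (hxy : h.proj x = h.proj y) :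
    x = y ∨ (x = a ∧ y = b) ∨ (x = b ∧ y = a) := by
  by_cases hx : x = b
  · by_cases hy : y = b
    · exact Or.inl (hx.trans hy.symm)
    · rw [hx, h.proj_right, h.proj_of_ne hy] at hxy
      exact Or.inr (Or.inr ⟨hx, (congrArg Subtype.val hxy).symm⟩)
  · by_cases hy : y = b
    · rw [hy, h.proj_right, h.proj_of_ne hx] at hxy
      exact Or.inr (Or.inl ⟨congrArg Subtype.val hxy, hy⟩)
    · rw [h.proj_of_ne hx, h.proj_of_ne hy] at hxy
      exact Or.inl (congrArg Subtype.val hxy)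

end Isolated

namespace Isolated

variable {L : Type*} [Lattice L] {a b : L}

/-- Prime bounds `t` and `s` around an isolated interval give fibre data over the sublattice
omitting `b`. -/
noncomputable def fibreData {F : Type*} [Lattice F] (h : Isolated a b) {t s : L} (hta : t ≤ a)
    (hbs : b ≤ s) (ht : ∀ x y, x ≤ a → y ≤ a → t ≤ x ⊔ y → t ≤ x ∨ t ≤ y)
    (hs : ∀ x y, b ≤ x → b ≤ y → x ⊓ y ≤ s → x ≤ s ∨ y ≤ s) {f₀ f₁ : F} (hf : f₀ < f₁) :
    @FibreData {x : L // x ≠ b} F h.lattice _ :=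
  letI := h.lattice
  { u := ⟨a, h.1.lt.ne⟩
    t := ⟨t, (hta.trans_lt h.1.lt).ne⟩
    s := h.proj s
    f₀ := f₀
    f₁ := f₁
    e := f₀
    t_le := hta
    le_s := h.le_proj h.1.lt.ne (h.1.le.trans hbs)
    f₀_le := le_rfl
    le_f₁ := hf.le
    prime_t := fun x y hx hy hxy => ht x y hx hy hxy
    prime_s := fun x y hx hy hxy => by
      have has : a ≤ h.proj s := h.le_proj h.1.lt.ne (h.1.le.trans hbs)
      by_cases hxa : (x : L) = a
      · exact Or.inl (hxa.le.trans has)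
      by_cases hya : (y : L) = a
      · exact Or.inr (hya.le.trans has)
      have hxb : b ≤ x := h.ge_of_gt (lt_of_le_of_ne hx (Ne.symm hxa))
      have hyb : b ≤ y := h.ge_of_gt (lt_of_le_of_ne hy (Ne.symm hya))
      have hxy' : (x : L) ⊓ y ≤ s := le_trans hxy (h.proj_le s)
      exact (hs x y hxb hyb hxy').imp (h.le_proj x.2) (h.le_proj y.2) }

/-- The lattice itself covers the sublattice omitting `b`. -/
noncomputable def cover {F : Type*} [Lattice F] (h : Isolated a b) {t s : L} (hta : t ≤ a)
    (hbs : b ≤ s) (ht : ∀ x y, x ≤ a → y ≤ a → t ≤ x ⊔ y → t ≤ x ∨ t ≤ y)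
    (hs : ∀ x y, b ≤ x → b ≤ y → x ⊓ y ≤ s → x ≤ s ∨ y ≤ s) {f₀ f₁ : F} (hf : f₀ < f₁)
    (htd : ∀ d : LatCon L, ¬ d.r a b → ∀ x y, x ≤ a → y ≤ a → d.r x y → t ≤ x → t ≤ y)
    (hsd : ∀ d : LatCon L, ¬ d.r a b → ∀ x y, b ≤ x → b ≤ y → d.r x y → x ≤ s → y ≤ s) :
    letI := h.lattice
    FibreData.Cover (h.fibreData hta hbs ht hs hf) L :=
  letI := h.lattice
  { proj := h.proj
    a := a
    b := b
    map_sup := fun x y => Subtype.ext (h.proj_sup x y)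
    map_inf := fun x y => Subtype.ext (h.proj_inf x y)
    surj := fun m => ⟨m, h.proj_of_ne m.2⟩
    proj_a := h.proj_of_ne h.1.lt.ne
    proj_b := h.proj_right
    eq_or := fun _ _ => h.eq_or_of_proj_eq
    a_lt := h.1.lt
    f_lt := hf
    stable_t := fun d hd x y hx hy hxy htx =>
      h.le_proj (hta.trans_lt h.1.lt).ne (htd d hd x y hx hy hxy (le_trans htx (h.proj_le x)))
    stable_s := fun d hd x y hx hy hxy hxs => by
      have hxs' : x ≤ s := by
        by_cases hxb : x = b
        · exact hxb.le.trans hbs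
        · exact (h.le_proj hxb le_rfl).trans (le_trans hxs (h.proj_le s))
      exact h.le_proj (h.proj y).2 ((h.proj_le y).trans (hsd d hd x y hx hy hxy hxs')) }

end Isolated

/-- Let `L` be a finite semidistributive lattice that has an isolated interval
`[a, b]` (assuming the existence of an FN lattice).  Then `Con L` can be
represented as the congruence lattice of an infinite semidistributive lattice `K`. -/
theorem statement16 (L : Type) [Lattice L] [Finite L] (hL : SD L)
    (a b : L) (hiso : Isolated a b)
    (hFN : ∃ (F : Type) (instF : Lattice F), IsFNP F instF) :
    ∃ (K : Type) (instK : Lattice K),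
      Infinite K ∧ SDP K instK ∧ ConIso K instK (LatCon L) := by
  obtain ⟨F, instF, hF⟩ := hFN
  have hF : IsFN F := hF
  have := hF.1
  obtain ⟨f₀⟩ : Nonempty F := inferInstance
  obtain ⟨f₁, hf⟩ := exists_gt_of_isFN hF f₀
  let ψ : LatCon L := LatCon.genSet {p | ∃ d : LatCon L, ¬ d.r a b ∧ d.r p.1 p.2}
  have hψ : ∀ d : LatCon L, ¬ d.r a b → ∀ x y, d.r x y → ψ.r x y :=
    fun d hd x y h c hc => hc (x, y) ⟨d, hd, h⟩
  obtain ⟨t, hta, ht, htψ⟩ := exists_prime_saturated hL.2 a ψ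
  obtain ⟨s, hbs, hs, hsψ⟩ := exists_prime_saturated (L := Lᵒᵈ) hL.1 (OrderDual.toDual b)
    (LatCon.dual ψ)
  let := hiso.lattice
  let D := hiso.fibreData hta hbs ht hs hf
  let C : FibreData.Cover D L := hiso.cover hta hbs ht hs hf
    (fun d hd x y hx hy h => htψ x y hx hy (hψ d hd x y h))
    (fun d hd x y hx hy h => hsψ x y hx hy (hψ d hd x y h))
  refine ⟨FibreData.Pt D, inferInstance, ?_, ⟨?_, ?_⟩, ?_⟩
  · exact Infinite.of_injective D.mid fun f g h => congrArg FibreData.Pt.f h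
  · refine FibreData.joinSD_pt (fun u x y z h h' => Subtype.ext ?_) hF.2.2.1
    exact hL.1 _ _ _ _ (congrArg Subtype.val h) (congrArg Subtype.val h')
  · refine FibreData.meetSD_pt (fun u x y z h h' => Subtype.ext ?_) hF.2.2.2
    exact hL.2 _ _ _ _ (congrArg Subtype.val h) (congrArg Subtype.val h')
  · exact C.nonempty_orderIso hF.2.1 (exists_lt_of_isFN hF) (exists_gt_of_isFN hF)
end

section
/- There is an infinite semidistributive lattice whose congruence lattice is isomorphic to (B₂)₊, the four-element Boolean lattice with a new least element adjoined (assuming the existence of an FN lattice, i.e., a simple, infinite, semidistributive lattice). -/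
/-! ### The pentagon with its isolated interval replaced by a lattice -/

/-- The pentagon `N₅ = {zero, side, one} ∪ [a, b]` with the isolated interval `[a, b]`
replaced by `F`. -/
inductive InflatedPentagon (F : Type) : Type
  | zero
  | one
  | side
  | mid (f : F)

namespace InflatedPentagon

variable {F : Type} [Lattice F]

/-- The order of the inflated pentagon. -/
protected def Le : InflatedPentagon F → InflatedPentagon F → Prop
  | zero, _ => True
  | _, one => True
  | side, side => True
  | mid f, mid g => f ≤ g
  | _, _ => False

/-- The join of the inflated pentagon. -/
protected def sup : InflatedPentagon F → InflatedPentagon F → InflatedPentagon F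
  | zero, x => x
  | x, zero => x
  | side, side => side
  | mid f, mid g => mid (f ⊔ g)
  | _, _ => one

/-- The meet of the inflated pentagon. -/
protected def inf : InflatedPentagon F → InflatedPentagon F → InflatedPentagon F
  | one, x => x
  | x, one => x
  | side, side => side
  | mid f, mid g => mid (f ⊓ g)
  | _, _ => zero

instance : Lattice (InflatedPentagon F) where
  le := InflatedPentagon.Le
  sup := InflatedPentagon.sup
  inf := InflatedPentagon.inf
  le_refl x := by cases x <;> simp [InflatedPentagon.Le]
  le_trans x y z := by
    cases x <;> cases y <;> cases z <;> simp [InflatedPentagon.Le]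
    exact le_trans
  le_antisymm x y := by
    cases x <;> cases y <;> simp [InflatedPentagon.Le]
    exact le_antisymm
  le_sup_left x y := by
    cases x <;> cases y <;> simp [InflatedPentagon.Le, InflatedPentagon.sup]
  le_sup_right x y := by
    cases x <;> cases y <;> simp [InflatedPentagon.Le, InflatedPentagon.sup]
  sup_le x y z := by
    cases x <;> cases y <;> cases z <;> simp [InflatedPentagon.Le, InflatedPentagon.sup]
    exact fun h h' => ⟨h, h'⟩
  inf_le_left x y := by
    cases x <;> cases y <;> simp [InflatedPentagon.Le, InflatedPentagon.inf]
  inf_le_right x y := by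
    cases x <;> cases y <;> simp [InflatedPentagon.Le, InflatedPentagon.inf]
  le_inf x y z := by
    cases x <;> cases y <;> cases z <;> simp [InflatedPentagon.Le, InflatedPentagon.inf]
    exact fun h h' => ⟨h, h'⟩

theorem sup_def (x y : InflatedPentagon F) : x ⊔ y = InflatedPentagon.sup x y := rfl

theorem inf_def (x y : InflatedPentagon F) : x ⊓ y = InflatedPentagon.inf x y := rfl

theorem sd (h : SD F) : SD (InflatedPentagon F) := by
  constructor
  · rintro u x y z rfl
    have key := fun x y z : F => h.1 (x ⊔ y) x y z rfl
    cases x <;> cases y <;> cases z <;>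
      simp [sup_def, inf_def, InflatedPentagon.sup, InflatedPentagon.inf]
    · exact fun h => h ▸ le_rfl
    all_goals exact key _ _ _
  · rintro u x y z rfl
    have key := fun x y z : F => h.2 (x ⊓ y) x y z rfl
    cases x <;> cases y <;> cases z <;>
      simp [sup_def, inf_def, InflatedPentagon.sup, InflatedPentagon.inf]
    · exact fun h => h ▸ le_rfl
    all_goals exact key _ _ _

/-- The two prime filters whose complements are the ideals `{zero, side}` and
`{zero} ∪ F`. -/
def inFilter : Fin 2 → InflatedPentagon F → Prop
  | _, zero => False
  | _, one => True
  | i, side => i = 1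
  | i, mid _ => i = 0

theorem inFilter_sup (i : Fin 2) (x y : InflatedPentagon F) :
    inFilter i (x ⊔ y) ↔ inFilter i x ∨ inFilter i y := by
  fin_cases i <;> cases x <;> cases y <;> simp [sup_def, InflatedPentagon.sup, inFilter]

theorem inFilter_inf (i : Fin 2) (x y : InflatedPentagon F) :
    inFilter i (x ⊓ y) ↔ inFilter i x ∧ inFilter i y := by
  fin_cases i <;> cases x <;> cases y <;> simp [inf_def, InflatedPentagon.inf, inFilter]

/-- The congruence collapsing `F`, together with the prime quotients separated only by
the filters with index in `S`. -/
def conOfSet (S : Set (Fin 2)) : LatCon (InflatedPentagon F) where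
  r x y := ∀ i ∉ S, (inFilter i x ↔ inFilter i y)
  refl' _ _ _ := Iff.rfl
  symm' h i hi := (h i hi).symm
  trans' h h' i hi := (h i hi).trans (h' i hi)
  sup' h h' i hi := by rw [inFilter_sup, inFilter_sup, h i hi, h' i hi]
  inf' h h' i hi := by rw [inFilter_inf, inFilter_inf, h i hi, h' i hi]

/-- The congruence attached to an element of `(B₂)₊`. -/
def conOf : WithBot (Set (Fin 2)) → LatCon (InflatedPentagon F)
  | ⊥ => ⊥
  | (S : Set (Fin 2)) => conOfSet S

theorem conOfSet_le_iff [Nonempty F] (S T : Set (Fin 2)) :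
    conOfSet (F := F) S ≤ conOfSet T ↔ S ⊆ T := by
  obtain ⟨f⟩ := ‹Nonempty F›
  constructor
  · intro h i hi
    by_contra hT
    have sep : ∀ e : InflatedPentagon F, (∀ j, inFilter j e ↔ j = i) → False := by
      intro e he
      have := h zero e (fun j hj =>
        iff_of_false id fun hj' => hj ((he j).mp hj' ▸ hi)) i hT
      exact this.mpr ((he i).mpr rfl)
    fin_cases i
    · exact sep (mid f) fun j => Iff.rfl
    · exact sep side fun j => Iff.rfl
  · exact fun h x y hxy i hi => hxy i fun hS => hi (h hS)

theorem conOf_le_iff [Nontrivial F] (s t : WithBot (Set (Fin 2))) :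
    conOf (F := F) s ≤ conOf t ↔ s ≤ t := by
  induction s using WithBot.recBotCoe with
  | bot => exact iff_of_true bot_le bot_le
  | coe S =>
    induction t using WithBot.recBotCoe with
    | bot =>
      refine iff_of_false (fun h => ?_) (WithBot.not_coe_le_bot S)
      obtain ⟨f, g, hfg⟩ := exists_pair_ne F
      have : (mid f : InflatedPentagon F) = mid g := h _ _ fun i _ => Iff.rfl
      exact hfg (by simpa using this)
    | coe T => exact (conOfSet_le_iff S T).trans WithBot.coe_le_coe.symm

/-- The restriction to `F` of a congruence. -/
def restrict (θ : LatCon (InflatedPentagon F)) : LatCon F where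
  r f g := θ.r (mid f) (mid g)
  refl' _ := θ.refl' _
  symm' h := θ.symm' h
  trans' h h' := θ.trans' h h'
  sup' h h' := θ.sup' h h'
  inf' h h' := θ.inf' h h'

theorem zero_rel_mid {θ : LatCon (InflatedPentagon F)} {x y : InflatedPentagon F}
    (h : θ.r x y) (hx : inFilter 0 x) (hy : ¬ inFilter 0 y) (g : F) :
    θ.r zero (mid g) := by
  have spread : ∀ f, θ.r zero (mid f) → θ.r zero (mid g) := fun f hf =>
    θ.inf' (θ.refl' (mid g)) (θ.sup' (θ.refl' side) hf)
  cases x <;> simp [inFilter] at hx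
  · have := θ.inf' (θ.refl' (mid g)) h
    cases y <;> simp [inFilter] at hy <;> exact θ.symm' this
  · rename_i f
    have := θ.inf' (θ.refl' (mid f)) h
    refine spread f ?_
    cases y <;> simp [inFilter] at hy <;>
      simp [inf_def, InflatedPentagon.inf] at this <;> exact θ.symm' this

theorem zero_rel_side {θ : LatCon (InflatedPentagon F)} {x y : InflatedPentagon F}
    (h : θ.r x y) (hx : inFilter 1 x) (hy : ¬ inFilter 1 y) :
    θ.r zero side := by
  have := θ.symm' (θ.inf' (θ.refl' side) h)
  cases x <;> simp [inFilter] at hx <;> cases y <;> simp [inFilter] at hy <;> exact this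

theorem restrict_eq_top_of_zero_rel_side {θ : LatCon (InflatedPentagon F)}
    (h : θ.r zero side) : restrict θ = ⊤ :=
  top_le_iff.mp fun f g _ =>
    have to_one (f : F) : θ.r (mid f) one := θ.sup' (θ.refl' (mid f)) h
    θ.trans' (to_one f) (θ.symm' (to_one g))

theorem restrict_eq_top_of_zero_rel_mid {θ : LatCon (InflatedPentagon F)}
    (h : ∀ f, θ.r zero (mid f)) : restrict θ = ⊤ :=
  top_le_iff.mp fun f g _ => θ.trans' (θ.symm' (h f)) (h g)

theorem eq_bot_of_restrict [Nontrivial F] {θ : LatCon (InflatedPentagon F)}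
    (h : restrict θ = ⊥) : θ = ⊥ := by
  have htop : restrict θ ≠ ⊤ := fun h' => by
    obtain ⟨f, g, hfg⟩ := exists_pair_ne F
    have : (⊥ : LatCon F).r f g := (h.symm.trans h') ▸ trivial
    exact hfg this
  have h0 : ∀ {x y}, θ.r x y → inFilter 0 x → inFilter 0 y := fun hxy hx => by
    by_contra hy
    exact htop (restrict_eq_top_of_zero_rel_mid (zero_rel_mid hxy hx hy))
  have h1 : ∀ {x y}, θ.r x y → inFilter 1 x → inFilter 1 y := fun hxy hx => by
    by_contra hy
    exact htop (restrict_eq_top_of_zero_rel_side (zero_rel_side hxy hx hy))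
  refine le_bot_iff.mp fun x y hxy => ?_
  have a := h0 hxy
  have b := h1 hxy
  have c := h0 (θ.symm' hxy)
  have d := h1 (θ.symm' hxy)
  change x = y
  cases x <;> cases y <;> simp [inFilter] at a b c d ⊢
  rename_i f g
  have : (restrict θ).r f g := hxy
  rwa [h] at this

open Classical in
/-- The join of those among `mid f` and `side` whose filter contains `x`. -/
noncomputable def rep (f : F) (x : InflatedPentagon F) : InflatedPentagon F :=
  (if inFilter 0 x then mid f else zero) ⊔ (if inFilter 1 x then side else zero)

theorem rel_rep {θ : LatCon (InflatedPentagon F)} (h : restrict θ = ⊤) (f : F)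
    (x : InflatedPentagon F) : θ.r x (rep f x) := by
  cases x <;> simp [rep, inFilter, sup_def, InflatedPentagon.sup]
  iterate 3 exact θ.refl' _
  rename_i g
  have : (restrict θ).r g f := h ▸ trivial
  exact this

theorem conOf_surjective [Nontrivial F] (hs : IsSimpleLat F) :
    Function.Surjective (conOf (F := F)) := by
  intro θ
  rcases hs.2 (restrict θ) with h | h
  · exact ⟨⊥, (eq_bot_of_restrict h).symm⟩
  obtain ⟨f⟩ : Nonempty F := inferInstance
  refine ⟨(({i | if i = 0 then θ.r zero (mid f) else θ.r zero side} : Set (Fin 2)) :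
    WithBot (Set (Fin 2))), le_antisymm (fun x y hxy => ?_) fun x y hxy i hi => ?_⟩
  · have h0 := hxy 0
    have h1 := hxy 1
    simp only [Set.mem_ofPred_eq, if_true, one_ne_zero, if_false] at h0 h1
    refine θ.trans' (rel_rep h f x) (θ.trans' (θ.sup' ?_ ?_) (θ.symm' (rel_rep h f y)))
    · by_cases hz : θ.r zero (mid f)
      · split_ifs <;> first | exact θ.refl' _ | exact hz | exact θ.symm' hz
      · have := h0 hz
        split_ifs <;> first | exact θ.refl' _ | exact absurd ‹_› (by tauto)
    · by_cases hz : θ.r zero side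
      · split_ifs <;> first | exact θ.refl' _ | exact hz | exact θ.symm' hz
      · have := h1 hz
        split_ifs <;> first | exact θ.refl' _ | exact absurd ‹_› (by tauto)
  · have aux : ∀ {x y}, θ.r x y → inFilter i x → inFilter i y := fun hxy hx => by
      by_contra hy
      apply hi
      fin_cases i
      · exact zero_rel_mid hxy hx hy f
      · exact zero_rel_side hxy hx hy
    exact ⟨aux hxy, aux (θ.symm' hxy)⟩

end InflatedPentagon

/-! ### STATEMENT 17 -/

/-- Assuming the existence of an FN lattice, there is an infinite semidistributive
lattice whose congruence lattice is isomorphic to `(B₂)₊`, the four-element Boolean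
lattice with a new least element adjoined. -/
theorem statement17 (hFN : ∃ (F : Type) (instF : Lattice F), IsFNP F instF) :
    ∃ (K : Type) (instK : Lattice K),
      Infinite K ∧ SDP K instK ∧ ConIso K instK (WithBot (Set (Fin 2))) := by
  obtain ⟨F, instF, hinf, hsimple, hsd⟩ := hFN
  refine ⟨InflatedPentagon F, inferInstance, ?_, InflatedPentagon.sd hsd, ?_⟩
  · exact Infinite.of_injective (InflatedPentagon.mid : F → _)
      fun _ _ h => InflatedPentagon.mid.inj h
  · exact ⟨(RelIso.ofSurjective
      (OrderEmbedding.ofMapLEIff InflatedPentagon.conOf InflatedPentagon.conOf_le_iff)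
      (InflatedPentagon.conOf_surjective hsimple)).symm⟩
end

section
/- There is an infinite semidistributive lattice whose congruence lattice is isomorphic to (B₂)₊₊, the four-element Boolean lattice with two new least elements successively adjoined (assuming the existence of an FN lattice, i.e., a simple, infinite, semidistributive lattice). -/
/-! ### STATEMENT 18 -/

/-! ### Doubling a point -/

/-- The doubling of `L` at `u`, realised inside `L × Prop`: only `u` carries two truth values. -/
@[ext]
structure Dbl {L : Type*} [Lattice L] (u : L) where
  val : L
  upper : Prop
  le_of_upper : upper → u ≤ val
  upper_of_lt : u < val → upper

namespace Dbl

variable {L : Type*} [Lattice L] {u : L}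

instance : Lattice (Dbl u) where
  le p q := p.val ≤ q.val ∧ (p.upper → q.upper)
  le_refl p := ⟨le_rfl, id⟩
  le_trans p q s h k := ⟨h.1.trans k.1, k.2 ∘ h.2⟩
  le_antisymm p q h k := Dbl.ext (le_antisymm h.1 k.1) (propext ⟨h.2, k.2⟩)
  sup p q :=
    { val := p.val ⊔ q.val
      upper := p.upper ∨ q.upper ∨ u < p.val ⊔ q.val
      le_of_upper := by
        rintro (h | h | h)
        · exact le_sup_of_le_left (p.le_of_upper h)
        · exact le_sup_of_le_right (q.le_of_upper h)
        · exact h.le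
      upper_of_lt := fun h => Or.inr (Or.inr h) }
  le_sup_left p q := ⟨le_sup_left, Or.inl⟩
  le_sup_right p q := ⟨le_sup_right, fun h => Or.inr (Or.inl h)⟩
  sup_le p q s h k := by
    refine ⟨sup_le h.1 k.1, ?_⟩
    rintro (hp | hq | hu)
    · exact h.2 hp
    · exact k.2 hq
    · exact s.upper_of_lt (hu.trans_le (sup_le h.1 k.1))
  inf p q :=
    { val := p.val ⊓ q.val
      upper := p.upper ∧ q.upper
      le_of_upper := fun h => le_inf (p.le_of_upper h.1) (q.le_of_upper h.2)
      upper_of_lt := fun h =>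
        ⟨p.upper_of_lt (h.trans_le inf_le_left), q.upper_of_lt (h.trans_le inf_le_right)⟩ }
  inf_le_left p q := ⟨inf_le_left, And.left⟩
  inf_le_right p q := ⟨inf_le_right, And.right⟩
  le_inf p q s h k := ⟨le_inf h.1 k.1, fun hp => ⟨h.2 hp, k.2 hp⟩⟩

@[simp] lemma val_sup (p q : Dbl u) : (p ⊔ q).val = p.val ⊔ q.val := rfl

@[simp] lemma val_inf (p q : Dbl u) : (p ⊓ q).val = p.val ⊓ q.val := rfl

@[simp] lemma upper_sup (p q : Dbl u) :
    (p ⊔ q).upper = (p.upper ∨ q.upper ∨ u < p.val ⊔ q.val) := rfl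

@[simp] lemma upper_inf (p q : Dbl u) : (p ⊓ q).upper = (p.upper ∧ q.upper) := rfl

lemma sd (h : SD L) : SD (Dbl u) := by
  constructor
  · rintro _ x y z rfl e
    have hv := congrArg val e
    have hu := congrArg upper e
    simp only [val_sup, upper_sup] at hv hu
    have hv' := h.1 _ _ _ _ rfl hv
    refine Dbl.ext (by simpa using hv') ?_
    simp only [upper_sup, val_inf, upper_inf, ← hv', ← hv] at hu ⊢
    grind
  · rintro _ x y z rfl e
    have hv := congrArg val e
    have hu := congrArg upper e
    simp only [val_inf, upper_inf] at hv hu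
    have hv' := h.2 _ _ _ _ rfl hv
    refine Dbl.ext (by simpa using hv') ?_
    simp only [upper_sup, upper_inf] at hu ⊢
    refine propext ⟨fun ⟨a, b⟩ => ⟨a, Or.inl b⟩, fun ⟨a, b⟩ => ?_⟩
    rcases b with b | b | b
    · exact ⟨a, b⟩
    · exact hu ▸ ⟨a, b⟩
    · by_contra hn
      have hy : ¬ y.upper := fun hy => hn ⟨a, hy⟩
      have hz : ¬ z.upper := fun hz => hn (hu ▸ ⟨a, hz⟩)
      have hm : u ≤ x.val ⊓ y.val := by
        rw [hv']; exact le_inf (x.le_of_upper a) b.le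
      have hm' : u ≤ x.val ⊓ z.val := hv ▸ hm
      have ey : u = y.val := (hm.trans inf_le_right).eq_of_not_lt (mt y.upper_of_lt hy)
      have ez : u = z.val := (hm'.trans inf_le_right).eq_of_not_lt (mt z.upper_of_lt hz)
      rw [← ey, ← ez, sup_idem] at b
      exact lt_irrefl _ b

variable (u) in
/-- The lower copy of `u`. -/
def lower : Dbl u := ⟨u, False, False.elim, fun h => (lt_irrefl _ h).elim⟩

/-- The section of the projection which takes the upper copy of `u`. -/
def lift (x : L) : Dbl u := ⟨x, u ≤ x, id, le_of_lt⟩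

lemma eq_or_of_val_eq {p q : Dbl u} (h : p.val = q.val) :
    p = q ∨ (p = lower u ∧ q = lift u) ∨ (p = lift u ∧ q = lower u) := by
  have key : ∀ {p q : Dbl u}, p.val = q.val → p.upper → ¬ q.upper →
      p = lift u ∧ q = lower u := by
    intro p q h hp hq
    have e : u = q.val := (h ▸ p.le_of_upper hp).eq_of_not_lt (mt q.upper_of_lt hq)
    exact ⟨Dbl.ext (h.trans e.symm) (by simp [lift, hp]), Dbl.ext e.symm (by simp [lower, hq])⟩
  by_cases hp : p.upper <;> by_cases hq : q.upper
  · exact Or.inl (Dbl.ext h (by simp [hp, hq]))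
  · exact Or.inr (Or.inr (key h hp hq))
  · exact Or.inr (Or.inl (key h.symm hq hp).symm)
  · exact Or.inl (Dbl.ext h (by simp [hp, hq]))

lemma lower_ne_lift : lower u ≠ lift u := fun h => by
  have := congrArg upper h
  simp [lower, lift] at this

variable (u) in
/-- The kernel of the projection `Dbl u → L`. -/
def ker : LatCon (Dbl u) where
  r p q := p.val = q.val
  refl' _ := rfl
  symm' := Eq.symm
  trans' := Eq.trans
  sup' h k := by simp [h, k]
  inf' h k := by simp [h, k]

lemma rel_of_val_eq {θ : LatCon (Dbl u)} (h : θ.r (lower u) (lift u)) {p q : Dbl u}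
    (e : p.val = q.val) : θ.r p q := by
  rcases eq_or_of_val_eq e with rfl | ⟨rfl, rfl⟩ | ⟨rfl, rfl⟩
  · exact θ.refl' _
  · exact h
  · exact θ.symm' h

lemma eq_ker_or_top (hs : IsSimpleLat L) {θ : LatCon (Dbl u)} (h : θ.r (lower u) (lift u)) :
    θ = ker u ∨ θ = ⊤ := by
  have conj : ∀ {p q p' q' : Dbl u}, p.val = p'.val → q.val = q'.val → θ.r p q → θ.r p' q' :=
    fun e₁ e₂ k => θ.trans' (rel_of_val_eq h e₁.symm) (θ.trans' k (rel_of_val_eq h e₂))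
  let φ : LatCon L :=
    { r := fun x y => θ.r (lift x) (lift y)
      refl' := fun x => θ.refl' _
      symm' := θ.symm'
      trans' := θ.trans'
      sup' := fun a b => conj (by rfl) (by rfl) (θ.sup' a b)
      inf' := fun a b => conj (by rfl) (by rfl) (θ.inf' a b) }
  have hφ : ∀ p q, θ.r p q ↔ φ.r p.val q.val := fun p q => ⟨conj (by rfl) (by rfl), conj (by rfl) (by rfl)⟩
  refine (hs.2 φ).imp (fun e => ?_) (fun e => ?_)
  · ext p q; rw [hφ, e]; exact Iff.rfl
  · ext p q; rw [hφ, e]; exact Iff.rfl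

/-- The join of `θ` and `ker u`, which merges the blocks of the two copies of `u`. -/
def joinKer (θ : LatCon (Dbl u)) : LatCon (Dbl u) :=
  have sup_one : ∀ (z : Dbl u) {x y : Dbl u}, θ.r x y → θ.r (x ⊔ z) (y ⊔ z) :=
    fun z _ _ h => θ.sup' h (θ.refl' z)
  have inf_one : ∀ (z : Dbl u) {x y : Dbl u}, θ.r x y → θ.r (x ⊓ z) (y ⊓ z) :=
    fun z _ _ h => θ.inf' h (θ.refl' z)
  let r : Dbl u → Dbl u → Prop := fun x y =>
    θ.r x y ∨ ((θ.r x (lower u) ∨ θ.r x (lift u)) ∧ (θ.r y (lower u) ∨ θ.r y (lift u)))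
  have rs : ∀ {x y}, r x y → r y x := fun h =>
    h.imp θ.symm' And.symm
  have rt : ∀ {x y z}, r x y → r y z → r x z := by
    rintro x y z (h | h) (k | k)
    · exact Or.inl (θ.trans' h k)
    · exact Or.inr ⟨k.1.imp (θ.trans' h) (θ.trans' h), k.2⟩
    · exact Or.inr ⟨h.1, h.2.imp (θ.trans' (θ.symm' k)) (θ.trans' (θ.symm' k))⟩
    · exact Or.inr ⟨h.1, k.2⟩
  have of_val : ∀ {x y p q : Dbl u}, θ.r x p → θ.r y q → p.val = q.val → r x y := by
    intro x y p q hx hy e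
    rcases eq_or_of_val_eq e with rfl | ⟨rfl, rfl⟩ | ⟨rfl, rfl⟩
    · exact Or.inl (θ.trans' hx (θ.symm' hy))
    · exact Or.inr ⟨Or.inl hx, Or.inr hy⟩
    · exact Or.inr ⟨Or.inr hx, Or.inl hy⟩
  have s1 : ∀ (z : Dbl u) {x y : Dbl u}, r x y → r (x ⊔ z) (y ⊔ z) := by
    rintro z x y (h | ⟨h | h, k | k⟩)
    · exact Or.inl (sup_one z h)
    all_goals exact of_val (sup_one z h) (sup_one z k) rfl
  have i1 : ∀ (z : Dbl u) {x y : Dbl u}, r x y → r (x ⊓ z) (y ⊓ z) := by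
    rintro z x y (h | ⟨h | h, k | k⟩)
    · exact Or.inl (inf_one z h)
    all_goals exact of_val (inf_one z h) (inf_one z k) rfl
  { r := r
    refl' := fun x => Or.inl (θ.refl' x)
    symm' := rs
    trans' := rt
    sup' := fun {x y x' y'} h k =>
      rt (s1 x' h) (by rw [sup_comm y, sup_comm y]; exact s1 y k)
    inf' := fun {x y x' y'} h k =>
      rt (i1 x' h) (by rw [inf_comm y, inf_comm y]; exact i1 y k) }

/-- In a simple lattice, an element comparable to all others is a bound. -/
lemma isTop_or_isBot_of_comparable (hs : IsSimpleLat L) (h : ∀ x, x ≤ u ∨ u ≤ x) :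
    IsTop u ∨ IsBot u := by
  let φ : LatCon L :=
    { r := fun x y => x ⊔ u = y ⊔ u
      refl' := fun _ => rfl
      symm' := Eq.symm
      trans' := Eq.trans
      sup' := fun {x y x' y'} a b => by rw [sup_sup_distrib_right, a, b, ← sup_sup_distrib_right]
      inf' := by
        have key : ∀ x y : L, x ⊓ y ⊔ u = (x ⊔ u) ⊓ (y ⊔ u) := by
          intro x y
          rcases h x with a | a <;> rcases h y with b | b
          · rw [sup_eq_right.2 a, sup_eq_right.2 b, inf_idem, sup_eq_right.2 (inf_le_of_left_le a)]
          · rw [sup_eq_right.2 a, sup_eq_left.2 b, inf_eq_left.2 (a.trans b), inf_eq_left.2 b,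
              sup_eq_right.2 a]
          · rw [sup_eq_left.2 a, sup_eq_right.2 b, inf_eq_right.2 (b.trans a), inf_eq_right.2 a,
              sup_eq_right.2 b]
          · rw [sup_eq_left.2 a, sup_eq_left.2 b, sup_eq_left.2 (le_inf a b)]
        intro x y x' y' a b
        rw [key, a, b, ← key] }
  rcases hs.2 φ with e | e
  · right
    intro x
    rcases h x with a | a
    · have : φ.r x u := by change x ⊔ u = u ⊔ u; simpa using a
      rw [e] at this
      exact le_of_eq (Eq.symm this)
    · exact a
  · left
    intro x
    have : φ.r x u := by rw [e]; trivial
    have : x ⊔ u = u ⊔ u := this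
    simpa using this

lemma con_cases (hs : IsSimpleLat L) (ht : ¬ IsTop u) (hb : ¬ IsBot u) (θ : LatCon (Dbl u)) :
    θ = ⊥ ∨ θ = ker u ∨ θ = ⊤ := by
  by_cases h : θ.r (lower u) (lift u)
  · exact Or.inr (eq_ker_or_top hs h)
  left
  have hker : ∀ {p q}, p.val = q.val → θ.r p q → p = q := by
    intro p q e hpq
    rcases eq_or_of_val_eq e with k | ⟨rfl, rfl⟩ | ⟨rfl, rfl⟩
    · exact k
    · exact (h hpq).elim
    · exact (h (θ.symm' hpq)).elim
  have hj : (joinKer θ).r (lower u) (lift u) :=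
    Or.inr ⟨Or.inl (θ.refl' _), Or.inr (θ.refl' _)⟩
  rcases eq_ker_or_top hs hj with e | e
  · ext p q
    refine ⟨fun hpq => hker ?_ hpq, fun hpq => ?_⟩
    · have : (joinKer θ).r p q := Or.inl hpq
      rw [e] at this
      exact this
    · have hpq' : p = q := hpq
      rw [hpq']
      exact θ.refl' q
  · refine ((isTop_or_isBot_of_comparable hs fun x => ?_).elim ht hb).elim
    have hx : (joinKer θ).r (lift x) (lower u) := by rw [e]; trivial
    have hx' : θ.r (lift x) (lower u) ∨ θ.r (lift x) (lift u) := by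
      rcases hx with hx | hx
      · exact Or.inl hx
      · exact hx.1
    by_contra! hc
    rcases hx' with hx | hx
    · have key : (lift x ⊔ lower u) ⊔ lift u = lift x ⊔ lower u := by
        have hlt : u < x ⊔ u := lt_of_le_of_ne le_sup_right fun e => hc.1 (e ▸ le_sup_left)
        refine Dbl.ext (by simp [lift, lower, sup_assoc]) ?_
        simp [lift, lower, sup_assoc, hlt]
      have a := θ.sup' hx (θ.refl' (lower u))
      rw [sup_idem] at a
      have b := θ.sup' a (θ.refl' (lift u))
      rw [key] at b
      have c : lower u ⊔ lift u = lift u := Dbl.ext (by simp [lift, lower]) (by simp [lift, lower])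
      rw [c] at b
      exact h (θ.trans' (θ.symm' a) b)
    · have key : (lift x ⊓ lift u) ⊓ lower u = lift x ⊓ lift u :=
        Dbl.ext (by simp [lift, lower, inf_assoc]) (by simp [lift, lower, hc.2])
      have a := θ.inf' hx (θ.refl' (lift u))
      rw [inf_idem] at a
      have b := θ.inf' a (θ.refl' (lower u))
      rw [key] at b
      have c : lift u ⊓ lower u = lower u := Dbl.ext (by simp [lift, lower]) (by simp [lift, lower])
      rw [c] at b
      exact h (θ.trans' (θ.symm' b) a)

lemma ker_ne_bot : ker u ≠ ⊥ := fun e => by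
  have : (ker u).r (lower u) (lift u) := rfl
  rw [e] at this
  exact lower_ne_lift this

lemma ker_ne_top (hs : IsSimpleLat L) : ker u ≠ ⊤ := fun e => by
  obtain ⟨x, y, hxy⟩ := hs.1
  have : (ker u).r (lift x) (lift y) := by rw [e]; trivial
  exact hxy this

end Dbl

/-! ### Substituting a lattice into the pentagon -/

/-- The pentagon with its long inner interval replaced by `G`. -/
inductive Pent (G : Type*)
  | bot
  | top
  | side
  | mid (g : G)

namespace Pent

variable {G : Type*} [Lattice G]

/-- The order of `Pent G`. -/
protected def le : Pent G → Pent G → Prop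
  | bot, _ => True
  | _, top => True
  | side, side => True
  | mid g, mid h => g ≤ h
  | _, _ => False

/-- The join of `Pent G`. -/
protected def sup : Pent G → Pent G → Pent G
  | bot, y => y
  | x, bot => x
  | side, side => side
  | mid g, mid h => mid (g ⊔ h)
  | _, _ => top

/-- The meet of `Pent G`. -/
protected def inf : Pent G → Pent G → Pent G
  | top, y => y
  | x, top => x
  | side, side => side
  | mid g, mid h => mid (g ⊓ h)
  | _, _ => bot

instance : Lattice (Pent G) where
  le := Pent.le
  sup := Pent.sup
  inf := Pent.inf
  le_refl x := by cases x <;> simp [Pent.le]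
  le_trans x y z h k := by
    cases x <;> cases y <;> cases z <;> simp_all [Pent.le]
    exact h.trans k
  le_antisymm x y h k := by
    cases x <;> cases y <;> simp_all [Pent.le]
    exact le_antisymm h k
  le_sup_left x y := by cases x <;> cases y <;> simp [Pent.le, Pent.sup]
  le_sup_right x y := by cases x <;> cases y <;> simp [Pent.le, Pent.sup]
  sup_le x y z h k := by cases x <;> cases y <;> cases z <;> simp_all [Pent.le, Pent.sup]
  inf_le_left x y := by cases x <;> cases y <;> simp [Pent.le, Pent.inf]
  inf_le_right x y := by cases x <;> cases y <;> simp [Pent.le, Pent.inf]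
  le_inf x y z h k := by cases x <;> cases y <;> cases z <;> simp_all [Pent.le, Pent.inf]

lemma sup_def (x y : Pent G) : x ⊔ y = Pent.sup x y := rfl

lemma inf_def (x y : Pent G) : x ⊓ y = Pent.inf x y := rfl

lemma sd (h : SD G) : SD (Pent G) := by
  constructor
  · rintro _ x y z rfl e
    rw [sup_def, sup_def] at e
    simp only [sup_def, inf_def]
    cases x <;> cases y <;> cases z <;> simp_all [Pent.sup, Pent.inf]
    exact (h.1 _ _ _ _ rfl e).symm.trans e |>.symm
  · rintro _ x y z rfl e
    rw [inf_def, inf_def] at e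
    simp only [sup_def, inf_def]
    cases x <;> cases y <;> cases z <;> simp_all [Pent.sup, Pent.inf]
    exact (h.2 _ _ _ _ rfl e).symm.trans e |>.symm

section Rel

variable (c : LatCon (Pent G))

lemma rel_comm (x y : Pent G) : c.r x y ↔ c.r y x := ⟨c.symm', c.symm'⟩

lemma rel_bot_mid (g : G) : c.r bot (mid g) ↔ c.r side top :=
  ⟨fun h => c.sup' h (c.refl' side), fun h => c.inf' h (c.refl' (mid g))⟩

lemma rel_mid_top (g : G) : c.r (mid g) top ↔ c.r bot side :=
  ⟨fun h => c.inf' h (c.refl' side), fun h => c.sup' h (c.refl' (mid g))⟩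

lemma rel_bot_top : c.r bot top ↔ c.r bot side ∧ c.r side top :=
  ⟨fun h => ⟨c.inf' h (c.refl' side), c.sup' h (c.refl' side)⟩, fun h => c.trans' h.1 h.2⟩

lemma rel_mid_side (g : G) : c.r (mid g) side ↔ c.r bot side ∧ c.r side top := by
  refine ⟨fun h => ⟨c.inf' h (c.refl' side), c.symm' (c.sup' h (c.refl' side))⟩, fun h => ?_⟩
  exact c.trans' (c.symm' ((rel_bot_mid c g).2 h.2)) h.1

end Rel

lemma con_ext {c d : LatCon (Pent G)} (h₁ : c.r side top ↔ d.r side top)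
    (h₂ : c.r bot side ↔ d.r bot side) (h₃ : ∀ g h, c.r (mid g) (mid h) ↔ d.r (mid g) (mid h)) :
    c = d := by
  ext x y
  cases x <;> cases y <;>
    simp only [c.refl', d.refl', rel_comm _ top bot, rel_comm _ side bot, rel_comm _ (mid _) bot,
      rel_comm _ top side, rel_comm _ top (mid _), rel_comm _ side (mid _), rel_bot_mid,
      rel_mid_top, rel_bot_top, rel_mid_side, h₁, h₂, h₃]

/-- The restriction of a congruence of `Pent G` to `G`. -/
def restrict (c : LatCon (Pent G)) : LatCon G where
  r g h := c.r (mid g) (mid h)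
  refl' _ := c.refl' _
  symm' := c.symm'
  trans' := c.trans'
  sup' h k := c.sup' h k
  inf' h k := c.inf' h k

lemma rel_mid_mid {c : LatCon (Pent G)} (h : c.r side top ∨ c.r bot side) (g k : G) :
    c.r (mid g) (mid k) := by
  rcases h with h | h
  · exact c.trans' (c.symm' ((rel_bot_mid c g).2 h)) ((rel_bot_mid c k).2 h)
  · exact c.trans' ((rel_mid_top c g).2 h) (c.symm' ((rel_mid_top c k).2 h))

/-- The extension of a congruence of `G` to `Pent G` by equality. -/
def extend (θ : LatCon G) : LatCon (Pent G) where
  r x y := match x, y with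
    | bot, bot => True
    | top, top => True
    | side, side => True
    | mid g, mid h => θ.r g h
    | _, _ => False
  refl' x := by cases x <;> simp [θ.refl']
  symm' {x y} h := by
    cases x <;> cases y <;> simp_all
    exact θ.symm' h
  trans' {x y z} h k := by
    cases x <;> cases y <;> cases z <;> simp_all
    exact θ.trans' h k
  sup' {x y x' y'} h k := by
    simp only [sup_def]
    cases x <;> cases y <;> simp only at h <;> cases x' <;> cases y' <;>
      simp_all [θ.sup', Pent.sup]
  inf' {x y x' y'} h k := by
    simp only [inf_def]
    cases x <;> cases y <;> simp only at h <;> cases x' <;> cases y' <;>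
      simp_all [θ.inf', Pent.inf]

/-- The two coordinates of the quotient of `Pent G` which is the four-element Boolean lattice. -/
def coord : Fin 2 → Pent G → Prop
  | _, bot => False
  | _, top => True
  | i, side => i = 1
  | i, mid _ => i = 0

lemma coord_sup (i : Fin 2) (x y : Pent G) : coord i (x ⊔ y) = (coord i x ∨ coord i y) := by
  rw [sup_def]
  fin_cases i <;> cases x <;> cases y <;> simp [coord, Pent.sup]

lemma coord_inf (i : Fin 2) (x y : Pent G) : coord i (x ⊓ y) = (coord i x ∧ coord i y) := by
  rw [inf_def]
  fin_cases i <;> cases x <;> cases y <;> simp [coord, Pent.inf]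

/-- The congruence of `Pent G` which forgets the coordinates in `S`. -/
def forget (S : Set (Fin 2)) : LatCon (Pent G) where
  r x y := ∀ i ∉ S, coord i x = coord i y
  refl' _ _ _ := rfl
  symm' h i hi := (h i hi).symm
  trans' h k i hi := (h i hi).trans (k i hi)
  sup' h k i hi := by rw [coord_sup, coord_sup, h i hi, k i hi]
  inf' h k i hi := by rw [coord_inf, coord_inf, h i hi, k i hi]

lemma forget_side_top (S : Set (Fin 2)) : (forget (G := G) S).r side top ↔ 0 ∈ S := by
  simp [forget, coord, Fin.forall_fin_two]

lemma forget_bot_side (S : Set (Fin 2)) : (forget (G := G) S).r bot side ↔ 1 ∈ S := by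
  simp [forget, coord, Fin.forall_fin_two]

lemma forget_mid_mid (S : Set (Fin 2)) (g h : G) : (forget S).r (mid g) (mid h) :=
  fun _ _ => rfl

lemma forget_le_forget {S T : Set (Fin 2)} :
    (forget S : LatCon (Pent G)) ≤ forget T ↔ S ≤ T := by
  refine ⟨fun h => ?_, fun h x y hxy i hi => hxy i fun hS => hi (h hS)⟩
  intro i hi
  fin_cases i
  · exact (forget_side_top T).1 (h _ _ ((forget_side_top S).2 hi))
  · exact (forget_bot_side T).1 (h _ _ ((forget_bot_side S).2 hi))

lemma extend_le_forget (θ : LatCon G) (S : Set (Fin 2)) : extend θ ≤ forget S := by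
  intro x y h i _
  cases x <;> cases y <;> simp_all [extend, coord]

lemma extend_restrict {c : LatCon (Pent G)} (h₁ : ¬ c.r side top) (h₂ : ¬ c.r bot side) :
    c = extend (restrict c) :=
  con_ext (iff_of_false h₁ id) (iff_of_false h₂ id) fun _ _ => Iff.rfl

lemma restrict_extend (θ : LatCon G) : restrict (extend θ) = θ := rfl

lemma extend_bot : extend (⊥ : LatCon G) = ⊥ := by
  refine con_ext (iff_of_false id fun h => ?_) (iff_of_false id fun h => ?_) fun g h => ?_
  · cases h
  · cases h
  · exact ⟨fun e => congrArg mid e, fun e => Pent.mid.inj e⟩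

lemma extend_top : extend (⊤ : LatCon G) = forget ∅ :=
  con_ext (iff_of_false id (by simp [forget_side_top]))
    (iff_of_false id (by simp [forget_bot_side]))
    fun g h => iff_of_true trivial (forget_mid_mid _ g h)

lemma eq_forget_of_or {c : LatCon (Pent G)} (h : c.r side top ∨ c.r bot side) :
    c = forget {i | i = 0 ∧ c.r side top ∨ i = 1 ∧ c.r bot side} :=
  con_ext (by simp [forget_side_top]) (by simp [forget_bot_side])
    fun g k => iff_of_true (rel_mid_mid h g k) (forget_mid_mid _ g k)

/-- If `G` has exactly the congruences `⊥ < μ < ⊤`, this enumerates those of `Pent G`. -/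
def enum (μ : LatCon G) : WithBot (WithBot (Set (Fin 2))) → LatCon (Pent G)
  | none => ⊥
  | some none => extend μ
  | some (some S) => forget S

lemma enum_le_enum {μ : LatCon G} (hb : μ ≠ ⊥) (ht : μ ≠ ⊤)
    (a b : WithBot (WithBot (Set (Fin 2)))) :
    enum μ a ≤ enum μ b ↔ a ≤ b := by
  have not_forget : ∀ (S : Set (Fin 2)) (θ : LatCon G), θ ≠ ⊤ → ¬ forget S ≤ extend θ := by
    intro S θ hθ h
    refine hθ (top_le_iff.1 fun g k _ => ?_)
    exact h _ _ (forget_mid_mid S g k)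
  have mu_not : ¬ extend μ ≤ (⊥ : LatCon (Pent G)) := by
    intro h
    rw [le_bot_iff, ← extend_bot] at h
    exact hb (by rw [← restrict_extend μ, h, restrict_extend])
  have bot_ne : (⊥ : LatCon G) ≠ ⊤ := fun e => hb (le_bot_iff.1 (e ▸ le_top))
  induction a using WithBot.recBotCoe with
  | bot => exact iff_of_true bot_le bot_le
  | coe a =>
    induction b using WithBot.recBotCoe with
    | bot =>
      refine iff_of_false ?_ (WithBot.not_coe_le_bot a)
      induction a using WithBot.recBotCoe with
      | bot => exact mu_not
      | coe S => intro h; exact not_forget S ⊥ bot_ne (extend_bot (G := G) ▸ h)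
    | coe b =>
      rw [WithBot.coe_le_coe]
      induction a using WithBot.recBotCoe with
      | bot =>
        refine iff_of_true ?_ bot_le
        induction b using WithBot.recBotCoe with
        | bot => exact le_rfl
        | coe T => exact extend_le_forget μ T
      | coe S =>
        induction b using WithBot.recBotCoe with
        | bot => exact iff_of_false (not_forget S μ ht) (WithBot.not_coe_le_bot S)
        | coe T => rw [WithBot.coe_le_coe]; exact forget_le_forget

lemma enum_surjective {μ : LatCon G} (h : ∀ θ : LatCon G, θ = ⊥ ∨ θ = μ ∨ θ = ⊤) :
    Function.Surjective (enum μ) := by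
  intro c
  by_cases hc : c.r side top ∨ c.r bot side
  · exact ⟨some (some _), (eq_forget_of_or hc).symm⟩
  · rw [not_or] at hc
    have e := extend_restrict hc.1 hc.2
    rcases h (restrict c) with k | k | k
    · exact ⟨none, by rw [e, k, extend_bot]; rfl⟩
    · exact ⟨some none, by rw [e, k]; rfl⟩
    · exact ⟨some (some ∅), by rw [e, k, extend_top]; rfl⟩

end Pent

lemma exists_not_isTop_not_isBot (L : Type*) [Lattice L] [Infinite L] :
    ∃ u : L, ¬ IsTop u ∧ ¬ IsBot u := by
  by_contra! h
  have ht : {x : L | IsTop x}.Subsingleton := fun a ha b hb => le_antisymm (hb a) (ha b)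
  have hb : {x : L | IsBot x}.Subsingleton := fun a ha b hb => le_antisymm (ha b) (hb a)
  refine Set.infinite_univ (α := L) ((ht.finite.union hb.finite).subset fun x _ => ?_)
  exact or_iff_not_imp_left.2 (h x)

/-- Assuming the existence of an FN lattice, there is an infinite semidistributive
lattice whose congruence lattice is isomorphic to `(B₂)₊₊`, the four-element
Boolean lattice with two new least elements successively adjoined. -/
theorem statement18 (hFN : ∃ (F : Type) (instF : Lattice F), IsFNP F instF) :
    ∃ (K : Type) (instK : Lattice K),
      Infinite K ∧ SDP K instK ∧ ConIso K instK (WithBot (WithBot (Set (Fin 2)))) := by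
  obtain ⟨F, instF, hinf, hsimple, hsd⟩ := hFN
  obtain ⟨u, ht, hb⟩ := exists_not_isTop_not_isBot F
  refine ⟨Pent (Dbl u), inferInstance, ?_, Pent.sd (Dbl.sd hsd), ?_⟩
  · refine Infinite.of_injective (fun x : F => Pent.mid (Dbl.lift x : Dbl u)) fun x y h => ?_
    exact congrArg Dbl.val (Pent.mid.inj h)
  · have hle := Pent.enum_le_enum (Dbl.ker_ne_bot (u := u)) (Dbl.ker_ne_top hsimple)
    let e : WithBot (WithBot (Set (Fin 2))) ↪o LatCon (Pent (Dbl u)) :=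
      OrderEmbedding.ofMapLEIff (Pent.enum (Dbl.ker u)) hle
    exact ⟨(RelIso.ofSurjective e (Pent.enum_surjective (Dbl.con_cases hsimple ht hb))).symm⟩
end
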